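/- Suppose M is unmixed with dim M = 3 and depth M = 2, and let S be an S_2-ification of M. Then N_R(M) = 2·dim_k Soc(H^2_m(M)) + dim_k Soc(H^3_m(M)) + dim_k Soc(H^2_m(S)). -/

import Mathlib

open IsLocalRing

universe u

namespace Paper

variable (R : Type u) [CommRing R]

/-- `dim_{R/I} Soc_I(N)` where `Soc_I(N) = (0 :_N I)`. -/
noncomputable def socDim (I : Ideal R) (N : Type u) [AddCommGroup N] [Module R N] : ℕ :=
  Module.finrank (R ⧸ I) (Submodule.torsionBySet R N (I : Set R))

/-- Krull dimension of a module (`⊥` for the zero module). -/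
noncomputable def mdim (M : Type u) [AddCommGroup M] [Module R M] : WithBot (WithTop ℕ) :=
  ringKrullDim (R ⧸ Module.annihilator R M)

/-- The index of reducibility of an ideal `q` on `M`: `dim_k Soc (M/qM)`. -/
noncomputable def ir [IsLocalRing R] (M : Type u) [AddCommGroup M] [Module R M]
    (q : Ideal R) : ℕ :=
  socDim R (maximalIdeal R) (M ⧸ (q • ⊤ : Submodule R M))

/-- `dim_k Soc (H^i_m(M))`. -/
noncomputable def socH [IsLocalRing R] (M : Type u) [AddCommGroup M] [Module R M] (i : ℕ) : ℕ :=
  socDim R (maximalIdeal R) ((localCohomology (maximalIdeal R) i).obj (ModuleCat.of R M))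

/-- A system of parameters of `M` (of length `d`): `d` elements of the maximal ideal such
that the quotient has finite length. -/
def IsSOP [IsLocalRing R] (M : Type u) [AddCommGroup M] [Module R M] (d : ℕ)
    (x : Fin d → R) : Prop :=
  (∀ i, x i ∈ maximalIdeal R) ∧
    IsFiniteLength R (M ⧸ (Ideal.span (Set.range x) • ⊤ : Submodule R M))

/-- A parameter element: an element occurring in some system of parameters of `M`. -/
def IsParamElement [IsLocalRing R] (M : Type u) [AddCommGroup M] [Module R M] (d : ℕ)
    (a : R) : Prop :=
  ∃ x : Fin d → R, IsSOP R M d x ∧ ∃ i, x i = a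

/-- The ideal `b(M) = ⋂ Ann (0 :_{M/(x_1,...,x_{i-1})M} x_i)`, the intersection running over
all systems of parameters `x_1, ..., x_d` of `M`. -/
noncomputable def bIdeal [IsLocalRing R] (M : Type u) [AddCommGroup M] [Module R M]
    (d : ℕ) : Ideal R :=
  ⨅ (x : Fin d → R) (_ : IsSOP R M d x) (i : Fin d),
    Module.annihilator R
      (Submodule.torsionBy R (M ⧸ (Ideal.span (x '' {j | j < i}) • ⊤ : Submodule R M)) (x i))

/-- A C-system of parameters: `x_i ∈ b(M/(x_{i+1},...,x_d)M)^3` for all `i`. -/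
def IsCSOP [IsLocalRing R] (M : Type u) [AddCommGroup M] [Module R M] (d : ℕ)
    (x : Fin d → R) : Prop :=
  IsSOP R M d x ∧ ∀ i : Fin d,
    x i ∈ (bIdeal R (M ⧸ (Ideal.span (x '' {j | i < j}) • ⊤ : Submodule R M)) ((i : ℕ) + 1)) ^ 3

/-- The depth of `M`: the supremum of the lengths of `M`-regular sequences contained in the
maximal ideal. -/
noncomputable def depth [IsLocalRing R] (M : Type u) [AddCommGroup M] [Module R M] :
    WithTop ℕ :=
  sSup {n : WithTop ℕ | ∃ rs : List R, (rs.length : WithTop ℕ) = n ∧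
    (∀ r ∈ rs, r ∈ maximalIdeal R) ∧ RingTheory.Sequence.IsRegular M rs}

/-- `M` is a Cohen-Macaulay module: `depth M = dim M`. -/
def IsCM [IsLocalRing R] (M : Type u) [AddCommGroup M] [Module R M] : Prop :=
  (depth R M : WithBot (WithTop ℕ)) = mdim R M

/-- A Cohen-Macaulay local ring. -/
def IsCMLocalRing (S : Type u) [CommRing S] [IsLocalRing S] : Prop :=
  IsNoetherianRing S ∧ IsCM S S

/-- `R` is a homomorphic image of a Cohen-Macaulay (Noetherian) local ring. -/
def IsQuotientOfCMLocalRing : Prop :=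
  ∃ (S : Type u) (_ : CommRing S) (_ : IsLocalRing S),
    IsCMLocalRing S ∧ ∃ f : S →+* R, Function.Surjective f

/-- The largest submodule of (the submodule) `N` whose dimension is strictly smaller than
that of `N`. -/
noncomputable def uComp (M : Type u) [AddCommGroup M] [Module R M] (N : Submodule R M) :
    Submodule R M :=
  sSup {P : Submodule R M | P ≤ N ∧ mdim R P < mdim R N}

/-- The unmixed component `U_M(0)` of `M`: the largest submodule of dimension `< dim M`. -/
noncomputable def unmixedComp (M : Type u) [AddCommGroup M] [Module R M] : Submodule R M :=
  uComp R M ⊤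

/-- The 0-th local cohomology `H^0_m(M)` realized as the submodule of elements annihilated by
some power of the maximal ideal. -/
def H0sub [IsLocalRing R] (M : Type u) [AddCommGroup M] [Module R M] : Submodule R M :=
  ⨆ n : ℕ, Submodule.torsionBySet R M (((maximalIdeal R) ^ n : Ideal R) : Set R)

/-- The quotient `P/N` of two submodules of `M`. -/
abbrev subQuot (M : Type u) [AddCommGroup M] [Module R M] (P N : Submodule R M) :=
  P ⧸ (Submodule.comap P.subtype N)

/-- `D_0 ⊆ D_1 ⊆ ⋯ ⊆ D_t = M` is the dimension filtration of `M`: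
`D_t = M`, each `D_{i-1}` is the largest submodule of `D_i` of strictly smaller dimension,
and `D_0 = H^0_m(M)`. -/
def IsDimFiltration [IsLocalRing R] (M : Type u) [AddCommGroup M] [Module R M]
    (t : ℕ) (D : Fin (t + 1) → Submodule R M) : Prop :=
  D (Fin.last t) = ⊤ ∧ (∀ i : Fin t, D i.castSucc = uComp R M (D i.succ)) ∧
    D 0 = H0sub R M

/-- `M` is sequentially Cohen-Macaulay: all quotients `D_i/D_{i-1}` of the dimension
filtration are Cohen-Macaulay. -/
def IsSeqCM [IsLocalRing R] (M : Type u) [AddCommGroup M] [Module R M] : Prop :=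
  ∃ (t : ℕ) (D : Fin (t + 1) → Submodule R M), IsDimFiltration R M t D ∧
    ∀ i : Fin t, IsCM R (subQuot R M (D i.succ) (D i.castSucc))

/-- `M` (of dimension `d`) is generalized Cohen-Macaulay: `H^i_m(M)` has finite length
for all `i < d`. -/
def IsGenCM [IsLocalRing R] (M : Type u) [AddCommGroup M] [Module R M] (d : ℕ) : Prop :=
  ∀ i < d, IsFiniteLength R ((localCohomology (maximalIdeal R) i).obj (ModuleCat.of R M))

/-- `α_n(M)`: the minimum of the indices of reducibility of parameter ideals of `M`
contained in `m^n`. -/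
noncomputable def alphaN [IsLocalRing R] (M : Type u) [AddCommGroup M] [Module R M]
    (d n : ℕ) : ℕ :=
  sInf {r : ℕ | ∃ x : Fin d → R, IsSOP R M d x ∧
    Ideal.span (Set.range x) ≤ (maximalIdeal R) ^ n ∧ r = ir R M (Ideal.span (Set.range x))}

/-- The limit value `α(M) = lim_n α_n(M)` (the supremum of the non-decreasing sequence). -/
noncomputable def alphaLim [IsLocalRing R] (M : Type u) [AddCommGroup M] [Module R M]
    (d : ℕ) : ℕ :=
  ⨆ n : ℕ, alphaN R M d (n + 1)

/-- `M` is unmixed: `dim R/p = dim M` for all associated primes `p`. -/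
def IsUnmixed (M : Type u) [AddCommGroup M] [Module R M] : Prop :=
  ∀ p ∈ associatedPrimes R M, ringKrullDim (R ⧸ p) = mdim R M

/-- Serre's condition `(S_2)` for a module. -/
def IsS2 (L : Type u) [AddCommGroup L] [Module R L] : Prop :=
  ∀ p : PrimeSpectrum R, p ∈ Module.support R L →
    min 2 (mdim (Localization.AtPrime p.asIdeal) (LocalizedModule p.asIdeal.primeCompl L)) ≤
      (depth (Localization.AtPrime p.asIdeal) (LocalizedModule p.asIdeal.primeCompl L) :
        WithBot (WithTop ℕ))

/-- `ι : M →ₗ[R] S` exhibits `S` as an `S_2`-ification of `M`. -/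
def IsS2ification [IsLocalRing R] (M S : Type u) [AddCommGroup M] [Module R M]
    [AddCommGroup S] [Module R S] (ι : M →ₗ[R] S) : Prop :=
  Function.Injective ι ∧ Module.Finite R S ∧ IsS2 R S ∧
    ∀ (p : Ideal R) [p.IsPrime], p ≠ maximalIdeal R →
      IsS2 (Localization.AtPrime p) (LocalizedModule p.primeCompl M) →
      Function.Surjective (IsLocalizedModule.map p.primeCompl
        (LocalizedModule.mkLinearMap p.primeCompl M)
        (LocalizedModule.mkLinearMap p.primeCompl S) ι)

end Paper

section
open CategoryTheory Limits Opposite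
namespace LC
noncomputable section
variable {R : Type u} [CommRing R]

abbrev CC (P : ChainComplex (ModuleCat.{u} R) ℕ) (Y : ModuleCat.{u} R) :
    CochainComplex (ModuleCat.{u} R) ℕ := P.linearYonedaObj R Y

def CCmapY (P : ChainComplex (ModuleCat.{u} R) ℕ) {Y Y' : ModuleCat.{u} R} (f : Y ⟶ Y') :
    CC P Y ⟶ CC P Y' where
  f i := ModuleCat.ofHom (Linear.rightComp R (P.X i) f)
  comm' i j _ := by
    refine ModuleCat.hom_ext (LinearMap.ext fun x => ?_)
    exact (Category.assoc (P.d j i) (show P.X i ⟶ Y from x) f).symm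

def CCmapP {P Q : ChainComplex (ModuleCat.{u} R) ℕ} (φ : P ⟶ Q) (Y : ModuleCat.{u} R) :
    CC Q Y ⟶ CC P Y where
  f i := ModuleCat.ofHom (Linear.leftComp R Y (φ.f i))
  comm' i j _ := by
    refine ModuleCat.hom_ext (LinearMap.ext fun x => ?_)
    have h : ∀ x : Q.X i ⟶ Y, P.d j i ≫ φ.f i ≫ x = φ.f j ≫ Q.d j i ≫ x := fun x => by
      rw [← Category.assoc, ← Category.assoc, HomologicalComplex.Hom.comm]
    exact h x

theorem abs_comp {C : Type*} [Category C] {E E' L L' K K' : C} (a : E' ⟶ E) (p : E ⟶ L)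
    (p' : E' ⟶ L') (l : L' ⟶ L) (q : L ⟶ K) (q' : L' ⟶ K') (k : K' ⟶ K) (h1 : a ≫ p = p' ≫ l)
    (h2 : l ≫ q = q' ≫ k) : a ≫ (p ≫ q) = (p' ≫ q') ≫ k := by
  rw [← Category.assoc, h1, Category.assoc, h2, Category.assoc]

theorem abs_inv {C : Type*} [Category C] {A B A' B' : C} (hm : A ⟶ B) (e : B ≅ B') (e' : A ≅ A')
    (f : A' ⟶ B') (h : hm ≫ e.hom = e'.hom ≫ f) : f ≫ e.inv = e'.inv ≫ hm := by
  rw [Iso.eq_inv_comp, ← Category.assoc, Iso.comp_inv_eq, h]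

theorem homologyOp_inv_nat {K L : CochainComplex (ModuleCat.{u} R) ℕ}
    (φ : K ⟶ L) (i : ℕ) :
    (HomologicalComplex.homologyMap φ i).op ≫ (K.homologyOp i).inv = (L.homologyOp i).inv ≫
    HomologicalComplex.homologyMap ((HomologicalComplex.opFunctor _ _).map φ.op) i :=
  abs_inv _ _ _ _ (HomologicalComplex.homologyOp_hom_naturality φ i)

theorem isoExt_naturality {X X' : ModuleCat.{u} R} (f : X ⟶ X') (P : ProjectiveResolution X)
    (Q : ProjectiveResolution X') (φ : P.complex ⟶ Q.complex)
    (comm : φ.f 0 ≫ Q.π.f 0 = P.π.f 0 ≫ f) (n : ℕ) (Y : ModuleCat.{u} R) :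
    ((Ext R (ModuleCat.{u} R) n).map f.op).app Y ≫ (P.isoExt (R := R) n Y).hom =
    (Q.isoExt (R := R) n Y).hom ≫ HomologicalComplex.homologyMap (CCmapP φ Y) n := by
  have h1 := congrArg Quiver.Hom.unop
    (ProjectiveResolution.isoLeftDerivedObj_inv_naturality f P Q φ comm
      ((linearYoneda R (ModuleCat.{u} R)).obj Y).rightOp n)
  have h2 := congrArg Quiver.Hom.unop (homologyOp_inv_nat (CCmapP φ Y) n)
  exact abs_comp _ _ _ _ _ _ _ h1 h2.symm

/-- The inverse system `R ⧸ J ^ n`. -/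
abbrev AF (J : Ideal R) : ℕᵒᵖ ⥤ ModuleCat.{u} R :=
  localCohomology.ringModIdeals (localCohomology.idealPowersDiagram J)

abbrev PP (J : Ideal R) (n : ℕ) : ProjectiveResolution ((AF J).obj (op n)) :=
  projectiveResolution _

abbrev KK (J : Ideal R) (i : ℕ) (Y : ModuleCat.{u} R) (n : ℕ) : ModuleCat.{u} R :=
  (CC (PP J n).complex Y).homology i

abbrev EF (J : Ideal R) (i : ℕ) (Y : ModuleCat.{u} R) : (ℕᵒᵖ)ᵒᵖ ⥤ ModuleCat.{u} R :=
  (localCohomology.diagram (localCohomology.idealPowersDiagram J) i).flip.obj Y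

abbrev KE (J : Ideal R) (i : ℕ) (Y : ModuleCat.{u} R) (n : ℕ) :
    (EF J i Y).obj (op (op n)) ≅ KK J i Y n := (PP J n).isoExt (R := R) i Y

abbrev trc (J : Ideal R) (i : ℕ) (Y : ModuleCat.{u} R) (n m : ℕ) (h : n ≤ m) :
    KK J i Y n ⟶ KK J i Y m :=
  (KE J i Y n).inv ≫ (EF J i Y).map (homOfLE h).op.op ≫ (KE J i Y m).hom

abbrev PL (J : Ideal R) (n m : ℕ) (h : n ≤ m) : (PP J m).complex ⟶ (PP J n).complex :=
  ProjectiveResolution.lift ((AF J).map (homOfLE h).op) (PP J m) (PP J n)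

theorem trc_eq (J : Ideal R) (i : ℕ) (Y : ModuleCat.{u} R) (n m : ℕ) (h : n ≤ m) :
    trc J i Y n m h = HomologicalComplex.homologyMap (CCmapP (PL J n m h) Y) i := by
  have := isoExt_naturality ((AF J).map (homOfLE h).op) (PP J m) (PP J n) (PL J n m h)
    (by exact (ProjectiveResolution.lift_commutes_zero _ _ _)) i Y
  exact (Iso.inv_comp_eq (KE J i Y n)).2 this

theorem abs_tr_id {C D : Type*} [Category C] [Category D] (F : C ⥤ D) {X : C} {Y : D}
    (e : F.obj X ≅ Y) (f : X ⟶ X) (hf : f = 𝟙 X) : e.inv ≫ F.map f ≫ e.hom = 𝟙 Y := by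
  subst hf; simp

theorem abs_tr_comp {C D : Type*} [Category C] [Category D] (F : C ⥤ D) {X X' X'' : C} {Y Y' Y'' : D}
    (e : F.obj X ≅ Y) (e' : F.obj X' ≅ Y') (e'' : F.obj X'' ≅ Y'')
    (f : X ⟶ X') (f' : X' ⟶ X'') (f'' : X ⟶ X'') (hf : f ≫ f' = f'') :
    (e.inv ≫ F.map f ≫ e'.hom) ≫ (e'.inv ≫ F.map f' ≫ e''.hom) = e.inv ≫ F.map f'' ≫ e''.hom := by
  subst hf; simp

def trl (J : Ideal R) (i : ℕ) (Y : ModuleCat.{u} R) (n m : ℕ) (h : n ≤ m) :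
    KK J i Y n →ₗ[R] KK J i Y m := (trc J i Y n m h).hom

instance (J : Ideal R) (i : ℕ) (Y : ModuleCat.{u} R) :
    DirectedSystem (fun n => (KK J i Y n : Type u)) (fun n m h => trl J i Y n m h) where
  map_self n x := by
    have := abs_tr_id (EF J i Y) (KE J i Y n) ((homOfLE (le_refl n)).op.op) rfl
    exact ConcreteCategory.congr_hom this x
  map_map l m n h h' x := by
    have := abs_tr_comp (EF J i Y) (KE J i Y n) (KE J i Y m) (KE J i Y l) ((homOfLE h).op.op)
      ((homOfLE h').op.op) ((homOfLE (h.trans h')).op.op) rfl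
    exact ConcreteCategory.congr_hom this x


/-- naturality in the coefficient module -/
def kmap (J : Ideal R) (i : ℕ) {Y Y' : ModuleCat.{u} R} (f : Y ⟶ Y') (n : ℕ) :
    KK J i Y n →ₗ[R] KK J i Y' n :=
  (HomologicalComplex.homologyMap (CCmapY (PP J n).complex f) i).hom

theorem CCmap_comm {P Q : ChainComplex (ModuleCat.{u} R) ℕ} (φ : P ⟶ Q) {Y Y' : ModuleCat.{u} R}
    (f : Y ⟶ Y') : CCmapY Q f ≫ CCmapP φ Y' = CCmapP φ Y ≫ CCmapY P f := by
  refine HomologicalComplex.hom_ext _ _ fun i => ?_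
  refine ModuleCat.hom_ext (LinearMap.ext fun x => ?_)
  exact (Category.assoc (φ.f i) (show Q.X i ⟶ Y from x) f).symm

theorem kmap_tr (J : Ideal R) (i : ℕ) {Y Y' : ModuleCat.{u} R} (f : Y ⟶ Y') (n m : ℕ) (h : n ≤ m) :
    kmap J i f m ∘ₗ trl J i Y n m h = trl J i Y' n m h ∘ₗ kmap J i f n := by
  unfold trl kmap
  rw [trc_eq, trc_eq, ← ModuleCat.hom_comp, ← ModuleCat.hom_comp,
    ← HomologicalComplex.homologyMap_comp, ← HomologicalComplex.homologyMap_comp, CCmap_comm]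

theorem CCmapY_id (P : ChainComplex (ModuleCat.{u} R) ℕ) (Y : ModuleCat.{u} R) :
    CCmapY P (𝟙 Y) = 𝟙 _ := by
  refine HomologicalComplex.hom_ext _ _ fun i => ?_
  refine ModuleCat.hom_ext (LinearMap.ext fun x => ?_)
  exact Category.comp_id (show P.X i ⟶ Y from x)

theorem CCmapY_comp (P : ChainComplex (ModuleCat.{u} R) ℕ) {Y Y' Y'' : ModuleCat.{u} R}
    (f : Y ⟶ Y') (g : Y' ⟶ Y'') :
    CCmapY P (f ≫ g) = CCmapY P f ≫ CCmapY P g := by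
  refine HomologicalComplex.hom_ext _ _ fun i => ?_
  refine ModuleCat.hom_ext (LinearMap.ext fun x => ?_)
  exact (Category.assoc (show P.X i ⟶ Y from x) f g).symm

theorem CCmapY_zero (P : ChainComplex (ModuleCat.{u} R) ℕ) {Y Y' : ModuleCat.{u} R} :
    CCmapY P (0 : Y ⟶ Y') = 0 := by
  refine HomologicalComplex.hom_ext _ _ fun i => ?_
  refine ModuleCat.hom_ext (LinearMap.ext fun x => ?_)
  exact Limits.comp_zero (f := (show P.X i ⟶ Y from x))

theorem CCmapY_add (P : ChainComplex (ModuleCat.{u} R) ℕ) {Y Y' : ModuleCat.{u} R}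
    (f g : Y ⟶ Y') :
    CCmapY P (f + g) = CCmapY P f + CCmapY P g := by
  refine HomologicalComplex.hom_ext _ _ fun i => ?_
  refine ModuleCat.hom_ext (LinearMap.ext fun x => ?_)
  exact Preadditive.comp_add _ _ _ (show P.X i ⟶ Y from x) f g

theorem CCmapY_smul (P : ChainComplex (ModuleCat.{u} R) ℕ) {Y Y' : ModuleCat.{u} R}
    (r : R) (f : Y ⟶ Y') :
    CCmapY P (r • f) = r • CCmapY P f := by
  refine HomologicalComplex.hom_ext _ _ fun i => ?_
  refine ModuleCat.hom_ext (LinearMap.ext fun x => ?_)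
  exact Linear.comp_smul _ _ _ (show P.X i ⟶ Y from x) r f

/-- A short exact sequence of coefficients gives one of complexes. -/
theorem CC_shortExact (P : ChainComplex (ModuleCat.{u} R) ℕ) [∀ i, Projective (P.X i)]
    (S : ShortComplex (ModuleCat.{u} R)) (hS : S.ShortExact) (w : CCmapY P S.f ≫ CCmapY P S.g = 0) :
    (ShortComplex.mk (CCmapY P S.f) (CCmapY P S.g) w).ShortExact := by
  have := hS.mono_f
  have := hS.epi_g
  refine HomologicalComplex.shortExact_of_degreewise_shortExact _ fun i => ?_
  refine ShortComplex.ShortExact.mk' ?_ ?_ ?_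
  · rw [ShortComplex.moduleCat_exact_iff]
    intro x hx
    have hx : (show P.X i ⟶ S.X₂ from x) ≫ S.g = 0 := hx
    exact ⟨hS.exact.lift _ hx, hS.exact.lift_f _ hx⟩
  · rw [ModuleCat.mono_iff_injective]
    intro x y h
    have h : (show P.X i ⟶ S.X₁ from x) ≫ S.f = (show P.X i ⟶ S.X₁ from y) ≫ S.f := h
    exact (cancel_mono S.f).1 h
  · rw [ModuleCat.epi_iff_surjective]
    intro x
    have h := Projective.factorThru_comp (P := P.X i) (show P.X i ⟶ S.X₃ from x) S.g
    exact ⟨Projective.factorThru (show P.X i ⟶ S.X₃ from x) S.g, h⟩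


section SES
variable (J : Ideal R) {S S' : ShortComplex (ModuleCat.{u} R)}

instance (n i : ℕ) : Projective ((PP J n).complex.X i) := (PP J n).projective i

abbrev CS (P : ChainComplex (ModuleCat.{u} R) ℕ) (S : ShortComplex (ModuleCat.{u} R)) :
    ShortComplex (CochainComplex (ModuleCat.{u} R) ℕ) :=
  ShortComplex.mk (CCmapY P S.f) (CCmapY P S.g) (by rw [← CCmapY_comp, S.zero, CCmapY_zero])

theorem CSe (hS : S.ShortExact) (n : ℕ) : (CS (PP J n).complex S).ShortExact :=
  CC_shortExact _ _ hS _

def kdel (hS : S.ShortExact) (i n : ℕ) : KK J i S.X₃ n →ₗ[R] KK J (i + 1) S.X₁ n :=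
  ((CSe J hS n).δ i (i + 1) rfl).hom

theorem kdel_tr (hS : S.ShortExact) (i : ℕ) (n m : ℕ) (h : n ≤ m) :
    kdel J hS i m ∘ₗ trl J i S.X₃ n m h = trl J (i + 1) S.X₁ n m h ∘ₗ kdel J hS i n := by
  unfold trl kdel
  rw [trc_eq, trc_eq, ← ModuleCat.hom_comp, ← ModuleCat.hom_comp]
  have := HomologicalComplex.HomologySequence.δ_naturality
    (S₁ := CS (PP J n).complex S) (S₂ := CS (PP J m).complex S)
    { τ₁ := CCmapP (PL J n m h) _, τ₂ := CCmapP (PL J n m h) _, τ₃ := CCmapP (PL J n m h) _,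
      comm₁₂ := (CCmap_comm _ _).symm, comm₂₃ := (CCmap_comm _ _).symm }
    (CSe J hS n) (CSe J hS m) i (i + 1) rfl
  exact congrArg ModuleCat.Hom.hom this.symm

theorem kdel_nat (hS : S.ShortExact) (hS' : S'.ShortExact) (φ : S ⟶ S') (i : ℕ) (n : ℕ) :
    kdel J hS' i n ∘ₗ kmap J i φ.τ₃ n = kmap J (i + 1) φ.τ₁ n ∘ₗ kdel J hS i n := by
  unfold kmap kdel
  rw [← ModuleCat.hom_comp, ← ModuleCat.hom_comp]
  have := HomologicalComplex.HomologySequence.δ_naturality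
    (S₁ := CS (PP J n).complex S) (S₂ := CS (PP J n).complex S')
    { τ₁ := CCmapY _ φ.τ₁, τ₂ := CCmapY _ φ.τ₂, τ₃ := CCmapY _ φ.τ₃,
      comm₁₂ := by
        dsimp only
        rw [← CCmapY_comp, ← CCmapY_comp, φ.comm₁₂]
      comm₂₃ := by
        dsimp only
        rw [← CCmapY_comp, ← CCmapY_comp, φ.comm₂₃] }
    (CSe J hS n) (CSe J hS' n) i (i + 1) rfl
  exact congrArg ModuleCat.Hom.hom this.symm

theorem k_exact₂ (hS : S.ShortExact) (i n : ℕ) :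
    Function.Exact (kmap J i S.f n) (kmap J i S.g n) := by
  have := (CSe J hS n).homology_exact₂ i
  rw [ShortComplex.ShortExact.moduleCat_exact_iff_function_exact] at this
  exact this

theorem k_exact₁ (hS : S.ShortExact) (i n : ℕ) :
    Function.Exact (kdel J hS i n) (kmap J (i + 1) S.f n) := by
  have := (CSe J hS n).homology_exact₁ i (i + 1) rfl
  rw [ShortComplex.ShortExact.moduleCat_exact_iff_function_exact] at this
  exact this

theorem k_exact₃ (hS : S.ShortExact) (i n : ℕ) :
    Function.Exact (kmap J i S.g n) (kdel J hS i n) := by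
  have := (CSe J hS n).homology_exact₃ i (i + 1) rfl
  rw [ShortComplex.ShortExact.moduleCat_exact_iff_function_exact] at this
  exact this

end SES

end
end LC
end

section
open CategoryTheory Limits Opposite
namespace LC
noncomputable section
variable {R : Type u} [CommRing R]

abbrev zc (K : CochainComplex (ModuleCat.{u} R) ℕ) : K.homology 0 ⟶ K.X 0 :=
  K.isoHomologyπ₀.inv ≫ K.iCycles 0

theorem zc_nat {K L : CochainComplex (ModuleCat.{u} R) ℕ} (φ : K ⟶ L) :
    HomologicalComplex.homologyMap φ 0 ≫ zc L = zc K ≫ φ.f 0 := by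
  simp [zc]

theorem zc_inj (K : CochainComplex (ModuleCat.{u} R) ℕ) : Function.Injective (zc K) := by
  rw [← ModuleCat.mono_iff_injective]; infer_instance

theorem zc_d (K : CochainComplex (ModuleCat.{u} R) ℕ) (z : K.homology 0) :
    K.d 0 1 (zc K z) = 0 := by
  have : zc K ≫ K.d 0 1 = 0 := by simp [zc]
  exact ConcreteCategory.congr_hom this z

theorem zc_surj (K : CochainComplex (ModuleCat.{u} R) ℕ) (x : K.X 0) (hx : K.d 0 1 x = 0) :
    ∃ z, zc K z = x := by
  let g : ModuleCat.of R R ⟶ K.X 0 := ModuleCat.ofHom (LinearMap.toSpanSingleton R (K.X 0) x)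
  have hg : g ≫ K.d 0 1 = 0 := by
    ext
    simp [g, hx]
  have h := K.liftCycles_i g 1 (by simp) hg
  refine ⟨K.isoHomologyπ₀.hom (K.liftCycles g 1 (by simp) hg (1 : R)), ?_⟩
  have h2 : (K.liftCycles g 1 (by simp) hg ≫ K.isoHomologyπ₀.hom) ≫ zc K = g := by
    rw [zc, Category.assoc, Iso.hom_inv_id_assoc, h]
  have := ConcreteCategory.congr_hom h2 (1 : R)
  refine Eq.trans this ?_
  simp [g]

theorem piSurj (J : Ideal R) (n : ℕ) : Function.Surjective ((PP J n).π.f 0) := by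
  rw [← ModuleCat.epi_iff_surjective]
  infer_instance

def pt (J : Ideal R) (n : ℕ) : (PP J n).complex.X 0 :=
  (piSurj J n (Submodule.Quotient.mk (p := J ^ n) (1 : R) : R ⧸ J ^ n)).choose

theorem pt_spec (J : Ideal R) (n : ℕ) :
    (PP J n).π.f 0 (pt J n) = (Submodule.Quotient.mk (p := J ^ n) (1 : R) : R ⧸ J ^ n) :=
  (piSurj J n (Submodule.Quotient.mk (p := J ^ n) (1 : R) : R ⧸ J ^ n)).choose_spec

theorem P_exact₀ (J : Ideal R) (n : ℕ) (p : (PP J n).complex.X 0) (hp : (PP J n).π.f 0 p = 0) :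
    ∃ q, (PP J n).complex.d 1 0 q = p := by
  have := (ShortComplex.moduleCat_exact_iff _).1 (PP J n).exact₀ p hp
  exact this

/-- the 0-cocycle attached to a class -/
def zcl (J : Ideal R) (Y : ModuleCat.{u} R) (n : ℕ) :
    KK J 0 Y n →ₗ[R] ((PP J n).complex.X 0 ⟶ Y) := (zc (CC (PP J n).complex Y)).hom

theorem zcl_d (J : Ideal R) (Y : ModuleCat.{u} R) (n : ℕ) (z : KK J 0 Y n)
    (q : (PP J n).complex.X 1) : zcl J Y n z ((PP J n).complex.d 1 0 q) = 0 := by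
  have := zc_d (CC (PP J n).complex Y) z
  have h : (PP J n).complex.d 1 0 ≫ zcl J Y n z = 0 := this
  exact ConcreteCategory.congr_hom h q

theorem zcl_inj (J : Ideal R) (Y : ModuleCat.{u} R) (n : ℕ) : Function.Injective (zcl J Y n) :=
  zc_inj (CC (PP J n).complex Y)

theorem zcl_surj (J : Ideal R) (Y : ModuleCat.{u} R) (n : ℕ) (x : (PP J n).complex.X 0 ⟶ Y)
    (hx : (PP J n).complex.d 1 0 ≫ x = 0) : ∃ z, zcl J Y n z = x :=
  zc_surj (CC (PP J n).complex Y) x hx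

theorem zcl_map (J : Ideal R) {Y Y' : ModuleCat.{u} R} (f : Y ⟶ Y') (n : ℕ) (z : KK J 0 Y n) :
    zcl J Y' n (kmap J 0 f n z) = zcl J Y n z ≫ f :=
  ConcreteCategory.congr_hom (zc_nat (CCmapY (PP J n).complex f)) z

theorem zcl_tr (J : Ideal R) (Y : ModuleCat.{u} R) (n m : ℕ) (h : n ≤ m) (z : KK J 0 Y n) :
    zcl J Y m (trl J 0 Y n m h z) = (PL J n m h).f 0 ≫ zcl J Y n z := by
  unfold trl
  rw [trc_eq]
  exact ConcreteCategory.congr_hom (zc_nat (CCmapP (PL J n m h) Y)) z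

/-- evaluation of cocycles -/
def thn (J : Ideal R) (Y : ModuleCat.{u} R) (n : ℕ) : KK J 0 Y n →ₗ[R] Y where
  toFun z := zcl J Y n z (pt J n)
  map_add' a b := by rw [map_add]; rfl
  map_smul' a b := by rw [map_smul]; rfl

theorem thn_eq (J : Ideal R) (Y : ModuleCat.{u} R) (n : ℕ) (z : KK J 0 Y n)
    (p p' : (PP J n).complex.X 0) (h : (PP J n).π.f 0 p = (PP J n).π.f 0 p') :
    zcl J Y n z p = zcl J Y n z p' := by
  obtain ⟨q, hq⟩ := P_exact₀ J n (p - p') (by rw [map_sub, h, sub_self])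
  rw [← sub_eq_zero, ← map_sub, ← hq, zcl_d]

theorem thn_tr (J : Ideal R) (Y : ModuleCat.{u} R) (n m : ℕ) (h : n ≤ m) (z : KK J 0 Y n) :
    thn J Y m (trl J 0 Y n m h z) = thn J Y n z := by
  change zcl J Y m (trl J 0 Y n m h z) (pt J m) = zcl J Y n z (pt J n)
  rw [zcl_tr]
  refine thn_eq J Y n z _ _ ?_
  have := ProjectiveResolution.lift_commutes_zero ((AF J).map (homOfLE h).op) (PP J m) (PP J n)
  refine (ConcreteCategory.congr_hom this (pt J m)).trans ?_
  refine (congrArg ((AF J).map (homOfLE h).op) (pt_spec J m)).trans (Eq.trans ?_ (pt_spec J n).symm)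
  rfl

theorem thn_map (J : Ideal R) {Y Y' : ModuleCat.{u} R} (f : Y ⟶ Y') (n : ℕ) (z : KK J 0 Y n) :
    thn J Y' n (kmap J 0 f n z) = f (thn J Y n z) := by
  change zcl J Y' n (kmap J 0 f n z) (pt J n) = f (zcl J Y n z (pt J n))
  rw [zcl_map]; rfl

theorem thn_inj (J : Ideal R) (Y : ModuleCat.{u} R) (n : ℕ) : Function.Injective (thn J Y n) := by
  rw [injective_iff_map_eq_zero]
  intro z hz
  have hz : zcl J Y n z (pt J n) = 0 := hz
  refine zcl_inj J Y n ?_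
  rw [map_zero]
  refine ModuleCat.hom_ext (LinearMap.ext fun p => ?_)
  obtain ⟨r, hr⟩ := Submodule.Quotient.mk_surjective _ ((show R ⧸ J ^ n from (PP J n).π.f 0 p))
  have := thn_eq J Y n z p (r • pt J n) (by
    rw [map_smul, pt_spec]
    refine Eq.trans hr.symm ?_
    rw [← mul_one r, ← smul_eq_mul, Submodule.Quotient.mk_smul, smul_eq_mul, mul_one]; rfl)
  refine Eq.trans this ?_
  rw [map_smul, hz, smul_zero]; rfl

theorem abs_zero {C : Type*} [Category C] [HasZeroMorphisms C] {A B D E : C} (f : A ⟶ B) (g : B ⟶ D)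
    (h : D ⟶ E) (hf : f ≫ g = 0) : f ≫ g ≫ h = 0 := by
  rw [← Category.assoc, hf, zero_comp]

theorem thn_range (J : Ideal R) (Y : ModuleCat.{u} R) (n : ℕ) (y : Y) :
    (∃ z, thn J Y n z = y) ↔ ∀ r ∈ J ^ n, r • y = 0 := by
  constructor
  · rintro ⟨z, rfl⟩ r hr
    change r • zcl J Y n z (pt J n) = 0
    rw [← map_smul]
    refine (thn_eq J Y n z (r • pt J n) 0 ?_).trans (map_zero _)
    rw [map_zero, map_smul, pt_spec]
    have : (Submodule.Quotient.mk (r • (1:R)) : R ⧸ J ^ n) = 0 := by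
      rw [Submodule.Quotient.mk_eq_zero]; simpa using hr
    exact this
  · intro h
    let g : (AF J).obj (op n) ⟶ Y := ModuleCat.ofHom
      (Submodule.liftQ (J ^ n) (LinearMap.toSpanSingleton R Y y) (by
        intro r hr; exact LinearMap.mem_ker.2 (h r hr)))
    obtain ⟨z, hz⟩ := zcl_surj J Y n ((PP J n).π.f 0 ≫ g) (by
      exact abs_zero _ _ _ ((PP J n).complex_d_comp_π_f_zero))
    refine ⟨z, ?_⟩
    change zcl J Y n z (pt J n) = y
    rw [hz]
    change g ((PP J n).π.f 0 (pt J n)) = y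
    rw [pt_spec]
    change LinearMap.toSpanSingleton R Y y 1 = y
    simp

theorem k_injective (J : Ideal R) (Y : ModuleCat.{u} R) [Injective Y] (i n : ℕ) :
    Subsingleton (KK J (i + 1) Y n) := by
  rw [← ModuleCat.isZero_iff_subsingleton, ← HomologicalComplex.exactAt_iff_isZero_homology,
    HomologicalComplex.exactAt_iff' _ i (i + 1) (i + 2) (by simp) (by simp),
    ShortComplex.moduleCat_exact_iff]
  intro x hx
  have hx : (PP J n).complex.d (i + 2) (i + 1) ≫ (show (PP J n).complex.X (i + 1) ⟶ Y from x) = 0 := hx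
  have e := (PP J n).complex_exactAt_succ i
  rw [HomologicalComplex.exactAt_iff' _ (i + 2) (i + 1) i (by simp) (by simp)] at e
  have h2 := e.comp_descToInjective _ hx
  exact ⟨e.descToInjective _ hx, h2⟩

end
end LC
end

section
open CategoryTheory Limits Opposite
namespace LC
noncomputable section
variable {R : Type u} [CommRing R]

abbrev Hd (J : Ideal R) (i : ℕ) (M : Type u) [AddCommGroup M] [Module R M] : Type u :=
  Module.DirectLimit (fun n => (KK J i (ModuleCat.of R M) n : Type u))
    (fun n m h => trl J i (ModuleCat.of R M) n m h)

/-- Local cohomology (our model). -/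
def H (J : Ideal R) (i : ℕ) (M : Type u) [AddCommGroup M] [Module R M] : Type u := Hd J i M

section
variable (J : Ideal R) (i : ℕ) (M : Type u) [AddCommGroup M] [Module R M]
instance : AddCommGroup (H J i M) := (inferInstance : AddCommGroup (Hd J i M))
instance : Module R (H J i M) := (inferInstance : Module R (Hd J i M))

def Hof (n : ℕ) : KK J i (ModuleCat.of R M) n →ₗ[R] H J i M := (Module.DirectLimit.of R ℕ _ _ n : _ →ₗ[R] Hd J i M)

variable {J i M}
theorem Hof_tr (n m : ℕ) (h : n ≤ m) (z) : Hof J i M m (trl J i (ModuleCat.of R M) n m h z) =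
    Hof J i M n z := Module.DirectLimit.of_f

theorem H_exists (z : H J i M) : ∃ n w, Hof J i M n w = z := Module.DirectLimit.exists_of z

theorem H_zero {n : ℕ} {z} (hz : Hof J i M n z = 0) :
    ∃ m, ∃ h : n ≤ m, trl J i (ModuleCat.of R M) n m h z = 0 := Module.DirectLimit.of.zero_exact hz

end

variable (J : Ideal R) (i : ℕ) {M N L : Type u} [AddCommGroup M] [Module R M]
  [AddCommGroup N] [Module R N] [AddCommGroup L] [Module R L]

def Hmap (f : M →ₗ[R] N) : H J i M →ₗ[R] H J i N :=
  Module.DirectLimit.map (fun n => kmap J i (ModuleCat.ofHom f) n)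
    (fun n m h => kmap_tr J i (ModuleCat.ofHom f) n m h)

theorem Hmap_of (f : M →ₗ[R] N) (n : ℕ) (z) :
    Hmap J i f (Hof J i M n z) = Hof J i N n (kmap J i (ModuleCat.ofHom f) n z) :=
  Module.DirectLimit.map_apply_of _ _ _

theorem Hmap_id : Hmap J i (LinearMap.id : M →ₗ[R] M) = LinearMap.id := by
  ext z
  obtain ⟨n, w, rfl⟩ := H_exists z
  rw [Hmap_of]
  have : kmap J i (ModuleCat.ofHom (LinearMap.id : M →ₗ[R] M)) n w = w := by
    unfold kmap
    rw [ModuleCat.ofHom_id, CCmapY_id, HomologicalComplex.homologyMap_id]; rfl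
  rw [this]; rfl

theorem Hmap_comp (g : N →ₗ[R] L) (f : M →ₗ[R] N) :
    Hmap J i (g ∘ₗ f) = Hmap J i g ∘ₗ Hmap J i f := by
  ext z
  obtain ⟨n, w, rfl⟩ := H_exists z
  rw [LinearMap.comp_apply, Hmap_of, Hmap_of, Hmap_of]
  unfold kmap
  rw [ModuleCat.ofHom_comp, CCmapY_comp, HomologicalComplex.homologyMap_comp]; rfl

theorem Hmap_add (f g : M →ₗ[R] N) : Hmap J i (f + g) = Hmap J i f + Hmap J i g := by
  ext z
  obtain ⟨n, w, rfl⟩ := H_exists z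
  rw [LinearMap.add_apply, Hmap_of, Hmap_of, Hmap_of, ← map_add]
  unfold kmap
  rw [ModuleCat.ofHom_add, CCmapY_add, HomologicalComplex.homologyMap_add]; rfl

theorem homologyMap_smul' {K K' : CochainComplex (ModuleCat.{u} R) ℕ} (φ : K ⟶ K') (r : R) (i : ℕ) :
    HomologicalComplex.homologyMap (r • φ) i = r • HomologicalComplex.homologyMap φ i := by
  have := ShortComplex.homologyMap_smul ((HomologicalComplex.shortComplexFunctor _ _ i).map φ) r
  exact this

theorem Hmap_smul (r : R) (f : M →ₗ[R] N) : Hmap J i (r • f) = r • Hmap J i f := by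
  ext z
  obtain ⟨n, w, rfl⟩ := H_exists z
  rw [LinearMap.smul_apply, Hmap_of, Hmap_of, ← map_smul]
  unfold kmap
  have : ModuleCat.ofHom (r • f) = r • ModuleCat.ofHom f := rfl
  rw [this, CCmapY_smul, homologyMap_smul']; rfl

/-- short exact sequences of modules -/
structure SES (f : M →ₗ[R] N) (g : N →ₗ[R] L) : Prop where
  inj : Function.Injective f
  surj : Function.Surjective g
  exact : Function.Exact f g

variable {f : M →ₗ[R] N} {g : N →ₗ[R] L}

abbrev SES.sc (h : SES f g) : ShortComplex (ModuleCat.{u} R) :=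
  ShortComplex.mk (ModuleCat.ofHom f) (ModuleCat.ofHom g) (by
    rw [← ModuleCat.ofHom_comp, h.exact.linearMap_comp_eq_zero]; rfl)

theorem SES.se (h : SES f g) : h.sc.ShortExact := by
  refine ShortComplex.ShortExact.mk' ?_ ?_ ?_
  · rw [ShortComplex.ShortExact.moduleCat_exact_iff_function_exact]; exact h.exact
  · rw [ModuleCat.mono_iff_injective]; exact h.inj
  · rw [ModuleCat.epi_iff_surjective]; exact h.surj

def del (h : SES f g) : H J i L →ₗ[R] H J (i + 1) M :=
  Module.DirectLimit.map (fun n => kdel J h.se i n) (fun n m hm => kdel_tr J h.se i n m hm)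

theorem del_of (h : SES f g) (n : ℕ) (z) :
    del J i h (Hof J i L n z) = Hof J (i + 1) M n (kdel J h.se i n z) :=
  Module.DirectLimit.map_apply_of _ _ _

/-- Abstract exactness lemma -/
theorem exact_aux {M N L : Type u} [AddCommGroup M] [Module R M]
    [AddCommGroup N] [Module R N] [AddCommGroup L] [Module R L] {a b c : ℕ}
    (F : H J a M →ₗ[R] H J b N) (G : H J b N →ₗ[R] H J c L)
    (φ : ∀ n, KK J a (ModuleCat.of R M) n →ₗ[R] KK J b (ModuleCat.of R N) n)
    (ψ : ∀ n, KK J b (ModuleCat.of R N) n →ₗ[R] KK J c (ModuleCat.of R L) n)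
    (hF : ∀ n z, F (Hof J a M n z) = Hof J b N n (φ n z))
    (hG : ∀ n z, G (Hof J b N n z) = Hof J c L n (ψ n z))
    (hψ : ∀ n m h, ψ m ∘ₗ trl J b (ModuleCat.of R N) n m h = trl J c _ n m h ∘ₗ ψ n)
    (e : ∀ n, Function.Exact (φ n) (ψ n)) : Function.Exact F G := by
  intro z
  constructor
  · intro hz
    obtain ⟨n, w, rfl⟩ := H_exists z
    rw [hG] at hz
    obtain ⟨m, h, hm⟩ := H_zero hz
    have h1 : ψ m (trl J b _ n m h w) = 0 := by
      rw [← hm]; exact LinearMap.congr_fun (hψ n m h) w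
    obtain ⟨y, hy⟩ := (e m _).1 h1
    exact ⟨Hof J a M m y, by rw [hF, hy, Hof_tr]⟩
  · rintro ⟨y, rfl⟩
    obtain ⟨n, w, rfl⟩ := H_exists y
    rw [hF, hG, (e n).apply_apply_eq_zero, map_zero]

theorem H_exact₂ (h : SES f g) : Function.Exact (Hmap J i f) (Hmap J i g) :=
  exact_aux J _ _ _ _ (Hmap_of J i f) (Hmap_of J i g) (kmap_tr J i _) (k_exact₂ J h.se i)

theorem H_exact₃ (h : SES f g) : Function.Exact (Hmap J i g) (del J i h) :=
  exact_aux J _ _ _ _ (Hmap_of J i g) (del_of J i h) (kdel_tr J h.se i) (k_exact₃ J h.se i)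

theorem H_exact₁ (h : SES f g) : Function.Exact (del J i h) (Hmap J (i + 1) f) :=
  exact_aux J _ _ _ _ (del_of J i h) (Hmap_of J (i + 1) f) (kmap_tr J (i + 1) _) (k_exact₁ J h.se i)

theorem del_nat {M' N' L' : Type u} [AddCommGroup M'] [Module R M']
    [AddCommGroup N'] [Module R N'] [AddCommGroup L'] [Module R L'] {f' : M' →ₗ[R] N'}
    {g' : N' →ₗ[R] L'} (h : SES f g) (h' : SES f' g') (a : M →ₗ[R] M') (b : N →ₗ[R] N')
    (c : L →ₗ[R] L') (h1 : f' ∘ₗ a = b ∘ₗ f) (h2 : g' ∘ₗ b = c ∘ₗ g) (z : H J i L) :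
    del J i h' (Hmap J i c z) = Hmap J (i + 1) a (del J i h z) := by
  obtain ⟨n, w, rfl⟩ := H_exists z
  rw [Hmap_of, del_of, del_of, Hmap_of]
  have := kdel_nat J h.se h'.se
    { τ₁ := ModuleCat.ofHom a, τ₂ := ModuleCat.ofHom b, τ₃ := ModuleCat.ofHom c
      comm₁₂ := by
        dsimp only
        rw [← ModuleCat.ofHom_comp, ← ModuleCat.ofHom_comp, h1]
      comm₂₃ := by
        dsimp only
        rw [← ModuleCat.ofHom_comp, ← ModuleCat.ofHom_comp, h2] } i n
  rw [← LinearMap.comp_apply]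
  exact congrArg (Hof J (i + 1) M' n) (LinearMap.congr_fun this w)

theorem H_injective (E : Type u) [AddCommGroup E] [Module R E] [Injective (ModuleCat.of R E)] :
    Subsingleton (H J (i + 1) E) := by
  refine ⟨fun a b => ?_⟩
  rw [← sub_eq_zero]
  obtain ⟨n, w, h⟩ := H_exists (a - b)
  have := k_injective J (ModuleCat.of R E) i n
  rw [← h, Subsingleton.elim w 0, map_zero]

variable (M) in
def theta : H J 0 M →ₗ[R] M :=
  Module.DirectLimit.lift R ℕ _ _ (fun n => thn J (ModuleCat.of R M) n)
    (fun n m h z => thn_tr J (ModuleCat.of R M) n m h z)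

theorem theta_of (n : ℕ) (z) : theta J M (Hof J 0 M n z) = thn J (ModuleCat.of R M) n z :=
  Module.DirectLimit.lift_of _ _ _

theorem theta_inj : Function.Injective (theta J M) := by
  rw [injective_iff_map_eq_zero]
  intro z hz
  obtain ⟨n, w, rfl⟩ := H_exists z
  rw [theta_of] at hz
  rw [(map_eq_zero_iff _ (thn_inj J _ n)).1 hz, map_zero]

theorem theta_nat (f : M →ₗ[R] N) (z : H J 0 M) : theta J N (Hmap J 0 f z) = f (theta J M z) := by
  obtain ⟨n, w, rfl⟩ := H_exists z
  rw [Hmap_of, theta_of, theta_of, thn_map]; rfl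

theorem theta_range (y : M) : (∃ z, theta J M z = y) ↔ ∃ n, ∀ r ∈ J ^ n, r • y = 0 := by
  constructor
  · rintro ⟨z, rfl⟩
    obtain ⟨n, w, rfl⟩ := H_exists z
    exact ⟨n, (thn_range J (ModuleCat.of R M) n _).1 ⟨w, (theta_of J n w).symm⟩⟩
  · rintro ⟨n, h⟩
    obtain ⟨w, hw⟩ := (thn_range J (ModuleCat.of R M) n y).2 h
    exact ⟨Hof J 0 M n w, by rw [theta_of]; exact hw⟩

end
end LC
end

section
open CategoryTheory Limits Opposite
namespace LC
noncomputable section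
variable {R : Type u} [CommRing R]

/-- the colimit cocone computing Mathlib's local cohomology at `Y` -/
def lcCocone (J : Ideal R) (i : ℕ) (Y : ModuleCat.{u} R) : Cocone (EF J i Y) :=
  ((evaluation _ _).obj Y).mapCocone
    (colimit.cocone (localCohomology.diagram (localCohomology.idealPowersDiagram J) i))

def lcIsColimit (J : Ideal R) (i : ℕ) (Y : ModuleCat.{u} R) : IsColimit (lcCocone J i Y) :=
  isColimitOfPreserves ((evaluation _ _).obj Y)
    (colimit.isColimit (localCohomology.diagram (localCohomology.idealPowersDiagram J) i))

theorem lc_pt (J : Ideal R) (i : ℕ) (Y : ModuleCat.{u} R) :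
    (lcCocone J i Y).pt = (localCohomology J i).obj Y := rfl

variable (J : Ideal R) (i : ℕ) (M : Type u) [AddCommGroup M] [Module R M]

def hCocone : Cocone (EF J i (ModuleCat.of R M)) where
  pt := ModuleCat.of R (H J i M)
  ι :=
    { app n := (KE J i _ n.unop.unop).hom ≫ ModuleCat.ofHom (Hof J i M n.unop.unop)
      naturality n m h := by
        refine ModuleCat.hom_ext (LinearMap.ext fun x => ?_)
        have h' : n.unop.unop ≤ m.unop.unop := h.unop.unop.le
        have := Hof_tr (J := J) (i := i) (M := M) n.unop.unop m.unop.unop h' ((KE J i _ n.unop.unop).hom x)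
        refine Eq.trans ?_ this
        have e : trl J i (ModuleCat.of R M) n.unop.unop m.unop.unop h'
          ((KE J i _ n.unop.unop).hom x) = (KE J i _ m.unop.unop).hom ((EF J i _).map h x) := by
          change (KE J i _ m.unop.unop).hom ((EF J i _).map _ ((KE J i _ n.unop.unop).inv ((KE J i _ n.unop.unop).hom x))) = _
          have e2 := ConcreteCategory.congr_hom (KE J i (ModuleCat.of R M) n.unop.unop).hom_inv_id x
          have e2 : (KE J i (ModuleCat.of R M) n.unop.unop).inv ((KE J i (ModuleCat.of R M) n.unop.unop).hom x) = x := e2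
          rw [e2]
          rfl
        rw [e]
        rfl }

def toLC : H J i M →ₗ[R] (lcCocone J i (ModuleCat.of R M)).pt :=
  Module.DirectLimit.lift R ℕ _ _
    (fun n => ((KE J i (ModuleCat.of R M) n).inv ≫ (lcCocone J i (ModuleCat.of R M)).ι.app (op (op n))).hom)
    (fun n m h x => by
      have e := (lcCocone J i (ModuleCat.of R M)).w (homOfLE h).op.op
      have h2 : trc J i (ModuleCat.of R M) n m h ≫ (KE J i (ModuleCat.of R M) m).inv ≫
          (lcCocone J i (ModuleCat.of R M)).ι.app (op (op m)) = (KE J i (ModuleCat.of R M) n).inv ≫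
          (lcCocone J i (ModuleCat.of R M)).ι.app (op (op n)) := by
        rw [← e]
        simp only [trc, Category.assoc, Iso.hom_inv_id_assoc]
      exact ConcreteCategory.congr_hom h2 x)

theorem toLC_of (n : ℕ) (z) : toLC J i M (Hof J i M n z) =
    (lcCocone J i (ModuleCat.of R M)).ι.app (op (op n)) ((KE J i (ModuleCat.of R M) n).inv z) :=
  Module.DirectLimit.lift_of _ _ _

def ofLC : (lcCocone J i (ModuleCat.of R M)).pt →ₗ[R] H J i M :=
  ((lcIsColimit J i (ModuleCat.of R M)).desc (hCocone J i M)).hom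

theorem ofLC_toLC (z : H J i M) : ofLC J i M (toLC J i M z) = z := by
  obtain ⟨n, w, rfl⟩ := H_exists z
  rw [toLC_of]
  have h := (lcIsColimit J i (ModuleCat.of R M)).fac (hCocone J i M) (op (op n))
  refine (ConcreteCategory.congr_hom h ((KE J i (ModuleCat.of R M) n).inv w)).trans ?_
  change Hof J i M n ((KE J i (ModuleCat.of R M) n).hom ((KE J i (ModuleCat.of R M) n).inv w)) = _
  have e2 := ConcreteCategory.congr_hom (KE J i (ModuleCat.of R M) n).inv_hom_id w
  exact congrArg _ e2

theorem abs_fac {C : Type*} [Category C] {A B D : C} (a : A ⟶ B) (b : B ⟶ D) (c : A ⟶ D)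
    (d : D ⟶ B) (h : a ≫ b = c) (h' : c ≫ d = a) : a ≫ b ≫ d = a ≫ 𝟙 B := by
  rw [← Category.assoc, h, h', Category.comp_id]

theorem toLC_ofLC (z) : toLC J i M (ofLC J i M z) = z := by
  have h : (lcIsColimit J i (ModuleCat.of R M)).desc (hCocone J i M) ≫
      ModuleCat.ofHom (toLC J i M) = 𝟙 _ := by
    refine (lcIsColimit J i (ModuleCat.of R M)).hom_ext fun n => ?_
    refine abs_fac _ _ _ _ ((lcIsColimit J i (ModuleCat.of R M)).fac (hCocone J i M) n) ?_
    refine ModuleCat.hom_ext (LinearMap.ext fun x => ?_)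
    refine Eq.trans (toLC_of J i M n.unop.unop ((KE J i _ n.unop.unop).hom x)) ?_
    have e2 := ConcreteCategory.congr_hom (KE J i (ModuleCat.of R M) n.unop.unop).hom_inv_id x
    exact congrArg ((lcCocone J i (ModuleCat.of R M)).ι.app n) e2
  exact ConcreteCategory.congr_hom h z

/-- comparison with Mathlib's local cohomology -/
def lcEquiv : H J i M ≃ₗ[R] (localCohomology J i).obj (ModuleCat.of R M) :=
  LinearEquiv.ofLinearMap (toLC J i M) (ofLC J i M) (LinearMap.ext (toLC_ofLC J i M))
    (LinearMap.ext (ofLC_toLC J i M))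

end
end LC
end

section
open CategoryTheory Limits Opposite
namespace LC
noncomputable section
variable {R : Type u} [CommRing R]

theorem embedInj (M : Type u) [AddCommGroup M] [Module R M] :
    ∃ (E : Type u) (_ : AddCommGroup E) (_ : Module R E) (f : M →ₗ[R] E),
      Module.Injective R E ∧ Function.Injective f := by
  let X := Injective.under (ModuleCat.of R M)
  refine ⟨X, inferInstance, inferInstance, (Injective.ι (ModuleCat.of R M)).hom, ?_, ?_⟩
  · rw [Module.injective_iff_injective_object]
    exact (inferInstance : Injective X)
  · exact (ModuleCat.mono_iff_injective (Injective.ι (ModuleCat.of R M))).1 inferInstance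

section
variable {M N L : Type u} [AddCommGroup M] [Module R M]
  [AddCommGroup N] [Module R N] [AddCommGroup L] [Module R L]

theorem ses_inj {f : M →ₗ[R] N} (hf : Function.Injective f) : SES f (LinearMap.range f).mkQ :=
  ⟨hf, Submodule.mkQ_surjective _, by rw [LinearMap.exact_iff, Submodule.ker_mkQ]⟩

theorem ses_sub (U : Submodule R M) : SES U.subtype U.mkQ :=
  ⟨U.subtype_injective, Submodule.mkQ_surjective _, by
    rw [LinearMap.exact_iff, Submodule.ker_mkQ, Submodule.range_subtype]⟩

variable (J : Ideal R)

theorem H_injective' (i : ℕ) (E : Type u) [AddCommGroup E] [Module R E] (h : Module.Injective R E) :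
    Subsingleton (H J (i + 1) E) := by
  have := (Module.injective_iff_injective_object R E).1 h
  exact H_injective J i E

variable (M) in
/-- `J`-power torsion modules -/
def Tors : Prop := ∀ y : M, ∃ n : ℕ, ∀ r ∈ J ^ n, r • y = 0

theorem H_tors (i : ℕ) : ∀ (M : Type u) [AddCommGroup M] [Module R M], Tors (H J i M) J := by
  induction i with
  | zero =>
    intro M _ _ z
    obtain ⟨n, hn⟩ := (theta_range J (theta J M z)).1 ⟨z, rfl⟩
    refine ⟨n, fun r hr => theta_inj J ?_⟩
    rw [map_smul, hn r hr, map_zero]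
  | succ i ih =>
    intro M _ _ z
    obtain ⟨E, _, _, f, hE, hf⟩ := embedInj (R := R) M
    have := H_injective' J i E hE
    obtain ⟨w, rfl⟩ := (H_exact₁ J i (ses_inj hf) z).1 (Subsingleton.elim _ _)
    obtain ⟨n, hn⟩ := ih _ w
    exact ⟨n, fun r hr => by rw [← map_smul, hn r hr, map_zero]⟩

variable (M) in
/-- the `J`-power torsion submodule -/
def Gam : Submodule R M where
  carrier := {y | ∃ n : ℕ, ∀ r ∈ J ^ n, r • y = 0}
  zero_mem' := ⟨0, by simp⟩
  add_mem' := by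
    rintro a b ⟨n, hn⟩ ⟨m, hm⟩
    refine ⟨max n m, fun r hr => ?_⟩
    rw [smul_add, hn r (Ideal.pow_le_pow_right (le_max_left _ _) hr),
      hm r (Ideal.pow_le_pow_right (le_max_right _ _) hr), add_zero]
  smul_mem' := by
    rintro c a ⟨n, hn⟩
    exact ⟨n, fun r hr => by rw [smul_comm, hn r hr, smul_zero]⟩

theorem Gam_tors : Tors (Gam M J) J := by
  rintro ⟨y, n, hn⟩
  exact ⟨n, fun r hr => Subtype.ext (hn r hr)⟩

theorem Gam_inj [IsNoetherianRing R] (hE : Module.Injective R M) :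
    Module.Injective R (Gam M J) := by
  refine Module.Baer.injective fun a g => ?_
  -- a bound for the exponents
  have hb : ∃ n : ℕ, ∀ r ∈ J ^ n, ∀ s : a, r • g s = 0 := by
    obtain ⟨T, hT⟩ := (IsNoetherian.noetherian (⊤ : Submodule R a))
    choose e he using fun s : a => Gam_tors J (g s)
    refine ⟨T.sup e, fun r hr s => ?_⟩
    have hs : s ∈ Submodule.span R (T : Set a) := by rw [hT]; trivial
    induction hs using Submodule.span_induction with
    | mem s hs => exact he s r (Ideal.pow_le_pow_right (Finset.le_sup hs) hr)
    | zero => simp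
    | add x y _ _ hx hy => rw [map_add, smul_add, hx, hy, add_zero]
    | smul c x _ hx => rw [map_smul, smul_comm, hx, smul_zero]
  obtain ⟨n, hn⟩ := hb
  obtain ⟨k, hk⟩ := Ideal.exists_pow_inf_eq_pow_smul J (M := R) a
  have hK := hk (n + k) (by omega)
  rw [Nat.add_sub_cancel] at hK
  have hvan : ∀ s : a, (s : R) ∈ J ^ (n + k) → g s = 0 := by
    intro s hs
    have h1 : (s : R) ∈ J ^ n • a := by
      have : (s : R) ∈ J ^ n • (J ^ k • ⊤ ⊓ a) := by
        rw [← hK]; exact ⟨by simpa using hs, s.2⟩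
      exact Submodule.smul_mono le_rfl inf_le_right this
    have : ∀ t, t ∈ J ^ n • a → ∃ ht : t ∈ a, g ⟨t, ht⟩ = 0 := by
      intro t ht
      refine Submodule.smul_induction_on ht ?_ ?_
      · intro r hr b hb
        have := hn r hr ⟨b, hb⟩
        rw [← map_smul] at this
        exact ⟨a.smul_mem r hb, this⟩
      · rintro x y ⟨hxa, hx⟩ ⟨hya, hy⟩
        refine ⟨a.add_mem hxa hya, ?_⟩
        have e : (⟨x + y, a.add_mem hxa hya⟩ : a) = ⟨x, hxa⟩ + ⟨y, hya⟩ := rfl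
        rw [e, map_add, hx, hy, add_zero]
    exact (this s h1).2
  let X := a ⧸ (Submodule.comap a.subtype (J ^ (n + k)))
  let f : X →ₗ[R] R ⧸ J ^ (n + k) := Submodule.mapQ _ _ a.subtype le_rfl
  have hf : Function.Injective f := by
    rw [← LinearMap.ker_eq_bot]
    exact Submodule.ker_liftQ_eq_bot _ _ _ (by rw [LinearMap.ker_comp, Submodule.ker_mkQ])
  let G : X →ₗ[R] M := Submodule.liftQ _ ((Gam M J).subtype ∘ₗ g) (by
    intro s hs
    rw [LinearMap.mem_ker, LinearMap.comp_apply, hvan s hs, map_zero])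
  obtain ⟨h, hh⟩ := hE.out f hf G
  let y : M := h (Submodule.Quotient.mk 1)
  have hy : y ∈ Gam M J := ⟨n + k, fun r hr => by
    change r • h (Submodule.Quotient.mk 1) = 0
    rw [← map_smul, ← Submodule.Quotient.mk_smul, (Submodule.Quotient.mk_eq_zero _).2, map_zero]
    simpa using hr⟩
  refine ⟨LinearMap.toSpanSingleton R _ (⟨y, hy⟩ : Gam M J), fun r hr => ?_⟩
  refine Subtype.ext ?_
  have := hh (Submodule.Quotient.mk ⟨r, hr⟩)
  change h (Submodule.Quotient.mk r) = ((g ⟨r, hr⟩ : Gam M J) : M) at this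
  rw [← this]
  change r • h (Submodule.Quotient.mk 1) = _
  rw [← map_smul, ← Submodule.Quotient.mk_smul, smul_eq_mul, mul_one]

theorem H0_surj_tors {g : M →ₗ[R] N} (hg : Function.Surjective g) (hM : Tors M J) :
    Function.Surjective (Hmap J 0 g) := by
  intro z
  obtain ⟨y, hy⟩ := hg (theta J N z)
  obtain ⟨w, hw⟩ := (theta_range J y).2 (hM y)
  refine ⟨w, theta_inj J ?_⟩
  rw [theta_nat, hw, hy]

theorem H_tors_zero [IsNoetherianRing R] (i : ℕ) : ∀ (L : Type u) [AddCommGroup L] [Module R L],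
    Tors L J → Subsingleton (H J (i + 1) L) := by
  induction i with
  | zero =>
    intro L _ _ hL
    obtain ⟨E, _, _, f, hE, hf⟩ := embedInj (R := R) L
    have hG := Gam_inj J hE
    let f' : L →ₗ[R] Gam E J := f.codRestrict (Gam E J) (fun y => by
      obtain ⟨n, hn⟩ := hL y
      exact ⟨n, fun r hr => by rw [← map_smul, hn r hr, map_zero]⟩)
    have hf' : Function.Injective f' := fun a b h => hf (congrArg Subtype.val h)
    have := H_injective' J 0 _ hG
    have hs := H0_surj_tors J (Submodule.mkQ_surjective (LinearMap.range f')) (Gam_tors (M := E) J)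
    refine subsingleton_of_forall_eq 0 fun z => ?_
    obtain ⟨w, rfl⟩ := (H_exact₁ J 0 (ses_inj hf') z).1 (Subsingleton.elim _ _)
    obtain ⟨v, rfl⟩ := hs w
    exact (H_exact₃ J 0 (ses_inj hf')).apply_apply_eq_zero v
  | succ i ih =>
    intro L _ _ hL
    obtain ⟨E, _, _, f, hE, hf⟩ := embedInj (R := R) L
    have hG := Gam_inj J hE
    let f' : L →ₗ[R] Gam E J := f.codRestrict (Gam E J) (fun y => by
      obtain ⟨n, hn⟩ := hL y
      exact ⟨n, fun r hr => by rw [← map_smul, hn r hr, map_zero]⟩)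
    have hf' : Function.Injective f' := fun a b h => hf (congrArg Subtype.val h)
    have := H_injective' J (i + 1) _ hG
    refine subsingleton_of_forall_eq 0 fun z => ?_
    obtain ⟨w, rfl⟩ := (H_exact₁ J (i + 1) (ses_inj hf') z).1 (Subsingleton.elim _ _)
    have : Subsingleton (H J (i + 1) ((Gam E J) ⧸ LinearMap.range f')) := ih _ (by
      intro y
      obtain ⟨y, rfl⟩ := Submodule.mkQ_surjective _ y
      obtain ⟨n, hn⟩ := Gam_tors J y
      exact ⟨n, fun r hr => by rw [← map_smul, hn r hr, map_zero]⟩)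
    rw [Subsingleton.elim w 0, map_zero]


theorem Hmap_smul_id (i : ℕ) (r : R) (z : H J i M) :
    Hmap J i (r • (LinearMap.id : M →ₗ[R] M)) z = r • z := by
  rw [Hmap_smul, Hmap_id]; rfl

theorem Hmap_comp_apply (i : ℕ) (g : N →ₗ[R] L) (f : M →ₗ[R] N) (z : H J i M) :
    Hmap J i g (Hmap J i f z) = Hmap J i (g ∘ₗ f) z := by
  rw [Hmap_comp]; rfl

theorem Hmap_zero (i : ℕ) : Hmap J i (0 : M →ₗ[R] N) = 0 := by
  have := Hmap_smul J i 0 (0 : M →ₗ[R] N)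
  rwa [zero_smul, zero_smul] at this

theorem Hmap_sum (i : ℕ) {ι : Type*} (s : Finset ι) (f : ι → (M →ₗ[R] N)) :
    Hmap J i (∑ k ∈ s, f k) = ∑ k ∈ s, Hmap J i (f k) := by
  classical
  induction s using Finset.induction_on with
  | empty => simp [Hmap_zero]
  | insert a s ha ih => rw [Finset.sum_insert ha, Finset.sum_insert ha, Hmap_add, ih]

def Hequiv (i : ℕ) (e : M ≃ₗ[R] N) : H J i M ≃ₗ[R] H J i N :=
  LinearEquiv.ofLinearMap (Hmap J i e.toLinearMap) (Hmap J i e.symm.toLinearMap)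
    (by rw [← Hmap_comp, LinearEquiv.comp_symm, Hmap_id])
    (by rw [← Hmap_comp, LinearEquiv.symm_comp, Hmap_id])

theorem H_subsing_of_subsing (i : ℕ) [Subsingleton M] : Subsingleton (H J i M) := by
  refine subsingleton_of_forall_eq 0 fun z => ?_
  have h : Hmap J i (LinearMap.id : M →ₗ[R] M) z = z := by rw [Hmap_id]; rfl
  rw [← h, Subsingleton.elim (LinearMap.id : M →ₗ[R] M) 0, Hmap_zero]; rfl

theorem Hmap_surj_of {f : M →ₗ[R] N} {g : N →ₗ[R] L} (h : SES f g) (i : ℕ)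
    [Subsingleton (H J (i + 1) M)] : Function.Surjective (Hmap J i g) := fun z =>
  (H_exact₃ J i h z).1 (Subsingleton.elim _ _)

theorem Hmap_inj_of {f : M →ₗ[R] N} {g : N →ₗ[R] L} (h : SES f g) (i : ℕ)
    [Subsingleton (H J i M)] : Function.Injective (Hmap J i g) := by
  rw [injective_iff_map_eq_zero]
  intro z hz
  obtain ⟨w, rfl⟩ := (H_exact₂ J i h z).1 hz
  rw [Subsingleton.elim w 0, map_zero]

theorem Hmap_inj_of' {f : M →ₗ[R] N} {g : N →ₗ[R] L} (h : SES f g) (i : ℕ)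
    [Subsingleton (H J i L)] : Function.Injective (Hmap J (i + 1) f) := by
  rw [injective_iff_map_eq_zero]
  intro z hz
  obtain ⟨w, rfl⟩ := (H_exact₁ J i h z).1 hz
  rw [Subsingleton.elim w 0, map_zero]

theorem Hmap_surj_of' {f : M →ₗ[R] N} {g : N →ₗ[R] L} (h : SES f g) (i : ℕ)
    [Subsingleton (H J i L)] : Function.Surjective (Hmap J i f) := fun z =>
  (H_exact₂ J i h z).1 (Subsingleton.elim _ _)

theorem pow_mem_pow' {t : R} (ht : t ∈ J) (n : ℕ) : t ^ n ∈ J ^ n := Ideal.pow_mem_pow ht n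

/-- `N ⧸ (0 : x) → N`, multiplication by `x`. -/
def xbar (x : R) (M : Type u) [AddCommGroup M] [Module R M] :
    (M ⧸ LinearMap.ker (x • (LinearMap.id : M →ₗ[R] M))) →ₗ[R] M :=
  Submodule.liftQ _ (x • (LinearMap.id : M →ₗ[R] M)) le_rfl

theorem xbar_comp (x : R) : xbar x M ∘ₗ Submodule.mkQ _ = x • (LinearMap.id : M →ₗ[R] M) :=
  Submodule.liftQ_mkQ _ _ _

theorem xbar_inj (x : R) : Function.Injective (xbar x M) := by
  rw [← LinearMap.ker_eq_bot]
  exact Submodule.ker_liftQ_eq_bot _ _ _ le_rfl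

theorem xbar_range (x : R) :
    LinearMap.range (xbar x M) = LinearMap.range (x • (LinearMap.id : M →ₗ[R] M)) :=
  Submodule.range_liftQ _ _ _

/-- the cokernel of `x` -/
theorem ses_xbar (x : R) : SES (xbar x M)
    (LinearMap.range (x • (LinearMap.id : M →ₗ[R] M))).mkQ :=
  ⟨xbar_inj x, Submodule.mkQ_surjective _, by
    rw [LinearMap.exact_iff, Submodule.ker_mkQ, xbar_range]⟩

theorem H_zero_of_tors_quot [IsNoetherianRing R] {t : R} (ht : t ∈ J)
    (h1 : Tors (LinearMap.ker (t • (LinearMap.id : M →ₗ[R] M))) J)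
    (h2 : Tors (M ⧸ LinearMap.range (t • (LinearMap.id : M →ₗ[R] M))) J) (i : ℕ) :
    Subsingleton (H J (i + 2) M) := by
  have s1 := H_tors_zero J (i + 1) _ h1
  have s2 := H_tors_zero J i _ h2
  have e1 := Hmap_inj_of J (ses_sub (LinearMap.ker (t • (LinearMap.id : M →ₗ[R] M)))) (i + 2)
  have e2 := Hmap_inj_of' J (ses_xbar (M := M) t) (i + 1)
  have e3 : ∀ z : H J (i + 2) M, t • z = 0 → z = 0 := by
    intro z hz
    apply e1
    apply e2
    rw [Hmap_comp_apply, xbar_comp, Hmap_smul_id, hz, map_zero, map_zero]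
  refine subsingleton_of_forall_eq 0 fun z => ?_
  obtain ⟨n, hn⟩ := H_tors J (i + 2) M z
  have h := hn _ (pow_mem_pow' J ht n)
  clear hn
  induction n with
  | zero => simpa using h
  | succ n ih =>
    apply ih
    apply e3
    rw [← mul_smul, ← pow_succ', h]

theorem H_kill_of_quot {y : R} (hy : y ∈ J) (c : R)
    (hreg : Function.Injective (y • (LinearMap.id : M →ₗ[R] M))) (i : ℕ)
    (hc : ∀ n : ℕ, ∀ z : H J i (M ⧸ LinearMap.range (y ^ n • (LinearMap.id : M →ₗ[R] M))), c • z = 0) :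
    ∀ z : H J (i + 1) M, c • z = 0 := by
  intro z
  obtain ⟨n, hn⟩ := H_tors J (i + 1) M z
  have hreg' : Function.Injective (y ^ n • (LinearMap.id : M →ₗ[R] M)) := by
    clear hc hn
    induction n with
    | zero => intro a b; simp
    | succ n ih =>
      intro a b h
      apply ih
      apply hreg
      simp only [LinearMap.smul_apply, LinearMap.id_apply] at h ⊢
      rw [← mul_smul, ← mul_smul, ← pow_succ', h]
  obtain ⟨w, rfl⟩ := (H_exact₁ J i (ses_inj hreg') z).1 (by
    rw [Hmap_smul_id]; exact hn _ (pow_mem_pow' J hy n))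
  rw [← map_smul, hc, map_zero]

end
end
end LC
end

section
open CategoryTheory Limits Opposite
namespace LC
noncomputable section
variable {R : Type u} [CommRing R] (J : Ideal R)

/-- length of the socle -/
def sl (A : Type u) [AddCommGroup A] [Module R A] : ℕ∞ :=
  Module.length R (Submodule.torsionBySet R A (J : Set R))

theorem mem_soc {A : Type u} [AddCommGroup A] [Module R A] (a : A) :
    a ∈ Submodule.torsionBySet R A (J : Set R) ↔ ∀ r ∈ J, r • a = 0 := by
  rw [Submodule.mem_torsionBySet_iff]
  exact ⟨fun h r hr => h ⟨r, hr⟩, fun h r => h r r.2⟩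

section
variable {A B C : Type u} [AddCommGroup A] [Module R A] [AddCommGroup B] [Module R B]
  [AddCommGroup C] [Module R C]

theorem sl_add (f : A →ₗ[R] B) (g : B →ₗ[R] C) (hf : Function.Injective f)
    (he : Function.Exact f g)
    (hs : ∀ s : C, (∀ r ∈ J, r • s = 0) → ∃ b : B, (∀ r ∈ J, r • b = 0) ∧ g b = s) :
    sl J B = sl J A + sl J C := by
  let f' : Submodule.torsionBySet R A (J : Set R) →ₗ[R] Submodule.torsionBySet R B (J : Set R) :=
    f.restrict (fun a ha => by
      rw [mem_soc] at ha ⊢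
      intro r hr
      rw [← map_smul, ha r hr, map_zero])
  let g' : Submodule.torsionBySet R B (J : Set R) →ₗ[R] Submodule.torsionBySet R C (J : Set R) :=
    g.restrict (fun a ha => by
      rw [mem_soc] at ha ⊢
      intro r hr
      rw [← map_smul, ha r hr, map_zero])
  refine Module.length_eq_add_of_exact f' g' ?_ ?_ ?_
  · intro a b h
    exact Subtype.ext (hf (congrArg Subtype.val h))
  · rintro ⟨s, h⟩
    obtain ⟨b, hb, hb'⟩ := hs s ((mem_soc J s).1 h)
    exact ⟨⟨b, (mem_soc J b).2 hb⟩, Subtype.ext hb'⟩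
  · rintro ⟨b, hb⟩
    constructor
    · intro h
      obtain ⟨a, ha⟩ := (he b).1 (congrArg Subtype.val h)
      refine ⟨⟨a, (mem_soc J a).2 fun r hr => hf ?_⟩, Subtype.ext ha⟩
      rw [map_smul, ha, map_zero, (mem_soc J b).1 hb r hr]
    · rintro ⟨⟨a, ha⟩, h⟩
      have : f a = b := congrArg Subtype.val h
      refine Subtype.ext ?_
      change g b = 0
      rw [← this, he.apply_apply_eq_zero]

theorem sl_congr (e : A ≃ₗ[R] B) : sl J A = sl J B := by
  have := sl_add J (e : A →ₗ[R] B) (0 : B →ₗ[R] PUnit.{u+1}) e.injective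
    (fun b => ⟨fun _ => ⟨e.symm b, by simp⟩, fun _ => rfl⟩) (fun s _ => ⟨0, by simp, Subsingleton.elim _ _⟩)
  rw [this]
  have h0 : sl J (R := R) PUnit.{u+1} = 0 := Module.length_eq_zero
  rw [h0, add_zero]
end

section split
variable {N : Type u} [AddCommGroup N] [Module R N] (x : R) (I : Ideal R) (i : ℕ)

abbrev Ux (x : R) (N : Type u) [AddCommGroup N] [Module R N] : Submodule R N :=
  LinearMap.ker (x • (LinearMap.id : N →ₗ[R] N))

abbrev Px (x : R) (N : Type u) [AddCommGroup N] [Module R N] : Submodule R N :=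
  LinearMap.range (x • (LinearMap.id : N →ₗ[R] N))

theorem xbar_zero (hx : x ∈ I) (hkill : ∀ c ∈ I, ∀ z : H J i N, c • z = 0)
    (hU1 : Subsingleton (H J (i + 1) (Ux x N))) (z) : Hmap J i (xbar x N) z = 0 := by
  obtain ⟨w, rfl⟩ := Hmap_surj_of J (ses_sub (Ux x N)) i z
  rw [Hmap_comp_apply, xbar_comp, Hmap_smul_id, hkill x hx]

theorem mem_of_mem_mul {I K : Ideal R} {x : R} (hx : x ∈ I * K) : x ∈ I := by
  have h : I * K ≤ I := Ideal.mul_le_left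
  exact h hx

theorem exists_repr {I K : Ideal R} {x : R} (hx : x ∈ I * K) :
    ∃ (r : ℕ) (y z : Fin r → R), (∀ k, y k ∈ I) ∧ (∀ k, z k ∈ K) ∧ x = ∑ k, y k * z k := by
  refine Submodule.mul_induction_on hx ?_ ?_
  · intro a ha b hb
    exact ⟨1, fun _ => a, fun _ => b, fun _ => ha, fun _ => hb, by simp⟩
  · rintro a b ⟨r, y, z, hy, hz, rfl⟩ ⟨r', y', z', hy', hz', rfl⟩
    refine ⟨r + r', Fin.append y y', Fin.append z z', ?_, ?_, ?_⟩
    · intro k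
      refine Fin.addCases (fun k => ?_) (fun k => ?_) k <;> simp [hy, hy']
    · intro k
      refine Fin.addCases (fun k => ?_) (fun k => ?_) k <;> simp [hz, hz']
    · rw [Fin.sum_univ_add]; simp

theorem split (hx : x ∈ I * (I ⊓ J)) (hIU : ∀ c ∈ I, ∀ n : N, x • n = 0 → c • n = 0)
    (hkill : ∀ c ∈ I, ∀ z : H J i N, c • z = 0)
    (hU1 : Subsingleton (H J (i + 1) (Ux x N))) (hU2 : Subsingleton (H J (i + 2) (Ux x N))) :
    sl J (H J i (N ⧸ Px x N)) = sl J (H J i N) + sl J (H J (i + 1) N) := by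
  have hxI : x ∈ I := mem_of_mem_mul hx
  have i1 := Hmap_inj_of J (ses_sub (Ux x N)) (i + 1)
  have i2 := Hmap_surj_of J (ses_sub (Ux x N)) (i + 1)
  rw [sl_congr J (LinearEquiv.ofBijective _ ⟨i1, i2⟩)]
  refine sl_add J (Hmap J i (Px x N).mkQ) (del J i (ses_xbar x)) ?_ (H_exact₃ J i (ses_xbar x)) ?_
  · rw [injective_iff_map_eq_zero]
    intro z hz
    obtain ⟨w, rfl⟩ := (H_exact₂ J i (ses_xbar x) z).1 hz
    exact xbar_zero J x I i hxI hkill hU1 w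
  obtain ⟨r, y, z, hy, hz, hxyz⟩ := exists_repr hx
  intro s hs
  let Z : (N ⧸ Ux x N) →ₗ[R] (Fin r → N) :=
    Submodule.liftQ _ (LinearMap.pi fun k => z k • (LinearMap.id : N →ₗ[R] N)) (by
      intro n hn
      rw [LinearMap.mem_ker]
      funext k
      exact hIU _ (hz k).1 n hn)
  let Y : (Fin r → N) →ₗ[R] N := ∑ k, y k • (LinearMap.proj k : (Fin r → N) →ₗ[R] N)
  have hYZ : Y ∘ₗ Z = xbar x N := by
    refine Submodule.linearMap_qext _ (LinearMap.ext fun n => ?_)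
    change Y (fun k => z k • n) = x • n
    rw [hxyz, Finset.sum_smul]
    simp [Y, mul_smul]
  have hZ : Function.Injective Z := by
    have := xbar_inj (M := N) x
    rw [← hYZ] at this
    exact Function.Injective.of_comp this
  let Yb : ((Fin r → N) ⧸ LinearMap.range Z) →ₗ[R] N ⧸ Px x N :=
    Submodule.liftQ _ ((Px x N).mkQ ∘ₗ Y) (by
      rintro _ ⟨q, rfl⟩
      rw [LinearMap.mem_ker, LinearMap.comp_apply]
      have e1 : Y (Z q) = xbar x N q := by rw [← hYZ]; rfl
      rw [e1, Submodule.mkQ_apply, Submodule.Quotient.mk_eq_zero, Px, ← xbar_range]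
      exact ⟨q, rfl⟩)
  have hZs : Hmap J (i + 1) Z s = 0 := by
    have h1 : (LinearMap.id : (Fin r → N) →ₗ[R] (Fin r → N)) =
        ∑ k, LinearMap.single R (fun _ => N) k ∘ₗ LinearMap.proj k := by
      refine LinearMap.ext fun v => ?_
      rw [LinearMap.sum_apply]
      exact (Finset.univ_sum_single v).symm
    have h2 : Hmap J (i + 1) Z s = Hmap J (i + 1) (LinearMap.id ∘ₗ Z) s := rfl
    rw [h2, h1, Hmap_comp, LinearMap.comp_apply, Hmap_sum, LinearMap.sum_apply]
    refine Finset.sum_eq_zero fun k _ => ?_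
    rw [Hmap_comp_apply J (i+1) _ Z, LinearMap.comp_assoc, Hmap_comp, LinearMap.comp_apply]
    obtain ⟨n, rfl⟩ := i2 s
    rw [Hmap_comp_apply J (i+1) _ (Ux x N).mkQ]
    have h3 : (LinearMap.proj k ∘ₗ Z) ∘ₗ (Ux x N).mkQ = z k • (LinearMap.id : N →ₗ[R] N) := rfl
    rw [h3, Hmap_smul_id]
    have h4 : z k • n = 0 := by
      apply i1
      rw [map_smul, hs _ (hz k).2, map_zero]
    rw [h4, map_zero]
  obtain ⟨c, hc⟩ := (H_exact₁ J i (ses_inj hZ) s).1 hZs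
  refine ⟨Hmap J i Yb c, ?_, ?_⟩
  · intro a ha
    rw [← map_smul]
    obtain ⟨d, hd⟩ := (H_exact₃ J i (ses_inj hZ) (a • c)).1 (by rw [map_smul, hc, hs a ha])
    rw [← hd, Hmap_comp_apply]
    have h5 : Yb ∘ₗ (LinearMap.range Z).mkQ = (Px x N).mkQ ∘ₗ Y := rfl
    rw [h5, ← Hmap_comp_apply]
    have h6 : Hmap J i Y d = 0 := by
      rw [Hmap_sum, LinearMap.sum_apply]
      refine Finset.sum_eq_zero fun k _ => ?_
      rw [Hmap_smul, LinearMap.smul_apply, hkill _ (hy k)]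
    rw [h6, map_zero]
  · rw [del_nat J i (ses_inj hZ) (ses_xbar x) LinearMap.id Y Yb (by rw [hYZ]; rfl) rfl, hc, Hmap_id]
    rfl

/-- the lower degree part -/
theorem split_low (hxI : x ∈ I)
    (hkill : ∀ c ∈ I, ∀ z : H J (i + 1) N, c • z = 0)
    (hU1 : Subsingleton (H J (i + 2) (Ux x N))) (h0 : Subsingleton (H J i N)) :
    sl J (H J i (N ⧸ Px x N)) = sl J (H J (i + 1) (N ⧸ Ux x N)) := by
  refine sl_congr J (LinearEquiv.ofBijective (del J i (ses_xbar x)) ⟨?_, ?_⟩)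
  · rw [injective_iff_map_eq_zero]
    intro z hz
    obtain ⟨w, rfl⟩ := (H_exact₃ J i (ses_xbar x) z).1 hz
    rw [Subsingleton.elim w 0, map_zero]
  · intro z
    exact (H_exact₁ J i (ses_xbar x) z).1 (xbar_zero J x I (i + 1) hxI hkill hU1 z)

end split
end
end LC
end

section
open CategoryTheory Limits Opposite
namespace LC
noncomputable section
set_option linter.unusedSectionVars false
open IsLocalRing Paper
variable {R : Type u} [CommRing R]

/-- dimension of `R/p` -/
def cd (p : PrimeSpectrum R) : ℕ∞ := Order.coheight p

theorem cd_lt {p q : PrimeSpectrum R} (h : p < q) : cd q + 1 ≤ cd p :=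
  Order.coheight_add_one_le h

theorem cd_mono {p q : PrimeSpectrum R} (h : p ≤ q) : cd q ≤ cd p :=
  Order.coheight_anti h

theorem cd_eq (p : PrimeSpectrum R) : ((cd p : ℕ∞) : WithBot ℕ∞) = ringKrullDim (R ⧸ p.asIdeal) := by
  rw [ringKrullDim_quotient, cd, Order.coheight_eq_krullDim_Ici]
  congr 1

theorem cd_le_dim (p : PrimeSpectrum R) {I : Ideal R} (h : I ≤ p.asIdeal) :
    ((cd p : ℕ∞) : WithBot ℕ∞) ≤ ringKrullDim (R ⧸ I) := by
  rw [cd_eq]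
  exact ringKrullDim_le_of_surjective (Ideal.Quotient.factor h) (Ideal.Quotient.factor_surjective h)

section
variable [IsLocalRing R]

theorem cd_max {p : PrimeSpectrum R} (h : p.asIdeal = maximalIdeal R) : cd p = 0 := by
  rw [cd, Order.coheight_eq_zero]
  intro q hq
  have : q.asIdeal ≤ maximalIdeal R := le_maximalIdeal q.2.ne_top
  rw [← h] at this
  exact this

theorem cd_zero {p : PrimeSpectrum R} (h : cd p ≤ 0) : p.asIdeal = maximalIdeal R := by
  have h : cd p = 0 := le_antisymm h bot_le
  rw [cd, Order.coheight_eq_zero] at h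
  have h1 : p ≤ (closedPoint R) := le_maximalIdeal p.2.ne_top
  exact le_antisymm h1 (h h1)

variable [IsNoetherianRing R]

theorem cd_le_card (p : PrimeSpectrum R) (s : Finset R)
    (hs : ∀ q : PrimeSpectrum R, p.asIdeal ≤ q.asIdeal → (∀ a ∈ s, a ∈ q.asIdeal) →
      q.asIdeal = maximalIdeal R) (hm : ∀ a ∈ s, a ∈ maximalIdeal R) : cd p ≤ s.card := by
  classical
  have h0 := cd_eq p
  have : Nontrivial (R ⧸ p.asIdeal) := Ideal.Quotient.nontrivial_iff.2 p.2.ne_top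
  have : IsLocalRing (R ⧸ p.asIdeal) := IsLocalRing.of_surjective' _ Ideal.Quotient.mk_surjective
  have hcm : (maximalIdeal (R ⧸ p.asIdeal)).comap (Ideal.Quotient.mk p.asIdeal) = maximalIdeal R := by
    have := IsLocalRing.of_surjective' (Ideal.Quotient.mk p.asIdeal) Ideal.Quotient.mk_surjective
    exact eq_maximalIdeal (Ideal.comap_isMaximal_of_surjective _ Ideal.Quotient.mk_surjective)
  have h1 : maximalIdeal (R ⧸ p.asIdeal) ∈
      (Ideal.span ((s.image (Ideal.Quotient.mk p.asIdeal) : Finset (R ⧸ p.asIdeal)) :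
        Set (R ⧸ p.asIdeal))).minimalPrimes := by
    refine ⟨⟨inferInstance, ?_⟩, ?_⟩
    · rw [Ideal.span_le]
      intro a ha
      simp only [Finset.coe_image, Set.mem_image] at ha
      obtain ⟨b, hb, rfl⟩ := ha
      have := hm b hb
      rw [← hcm] at this
      exact this
    · rintro q ⟨hq, hsq⟩ _
      have := hs ⟨q.comap (Ideal.Quotient.mk p.asIdeal), inferInstance⟩ (by
        intro a ha
        change Ideal.Quotient.mk p.asIdeal a ∈ q
        rw [Ideal.Quotient.eq_zero_iff_mem.2 ha]
        exact q.zero_mem) (by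
        intro a ha
        change Ideal.Quotient.mk p.asIdeal a ∈ q
        apply hsq
        apply Ideal.subset_span
        simp only [Finset.coe_image, Set.mem_image]
        exact ⟨a, ha, rfl⟩)
      intro a ha
      obtain ⟨b, rfl⟩ := Ideal.Quotient.mk_surjective a
      have hb : b ∈ maximalIdeal R := by rw [← hcm]; exact ha
      rw [← this] at hb
      exact hb
  have h2 := Ideal.height_le_card_of_mem_minimalPrimes_span_finset h1
  rw [← maximalIdeal_height_eq_ringKrullDim] at h0
  have h3 : cd p = (maximalIdeal (R ⧸ p.asIdeal)).height := by exact_mod_cast h0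
  rw [h3]
  exact h2.trans (by exact_mod_cast Finset.card_image_le)


theorem avoid (K : Ideal R) (F : Set (Ideal R)) (hF : F.Finite) (hp : ∀ p ∈ F, p.IsPrime)
    (hK : ∀ p ∈ F, ¬ K ≤ p) : ∃ y ∈ K, ∀ p ∈ F, y ∉ p := by
  by_contra hcon
  push Not at hcon
  obtain ⟨p, hp1, hp2⟩ := (K.subset_union_prime_finite hF (f := id) 0 0 fun p h _ _ => hp p h).1 (by
    intro y hy
    obtain ⟨p, hp, hy⟩ := hcon y hy
    exact Set.mem_biUnion hp hy)
  exact hK p hp1 hp2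


theorem exists_step (I K : Ideal R) (n : ℕ) (h : ∀ p : PrimeSpectrum R, I ≤ p.asIdeal → cd p ≤ n + 1)
    (hK : ∀ p : PrimeSpectrum R, K ≤ p.asIdeal → cd p ≤ n)
    (F : Set (Ideal R)) (hF : F.Finite) (hFp : ∀ p ∈ F, p.IsPrime) (hFK : ∀ p ∈ F, ¬ K ≤ p) :
    ∃ y ∈ K, (∀ p ∈ F, y ∉ p) ∧ ∀ p : PrimeSpectrum R, I ≤ p.asIdeal → y ∈ p.asIdeal → cd p ≤ n := by
  obtain ⟨y, hy, hyF⟩ := avoid K (F ∪ {p ∈ I.minimalPrimes | ¬ K ≤ p})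
    (hF.union (I.finite_minimalPrimes_of_isNoetherianRing.subset (Set.sep_subset _ _)))
    (by rintro p (hp | hp)
        · exact hFp p hp
        · exact hp.1.1.1)
    (by rintro p (hp | hp)
        · exact hFK p hp
        · exact hp.2)
  refine ⟨y, hy, fun p hp => hyF p (Or.inl hp), fun p hp hyp => ?_⟩
  obtain ⟨q, hq, hqp⟩ := Ideal.exists_minimalPrimes_le hp
  by_cases hKq : K ≤ q
  · exact hK p (hKq.trans hqp)
  have h1 : y ∉ q := hyF q (Or.inr ⟨hq, hKq⟩)
  have h2 : (⟨q, hq.1.1⟩ : PrimeSpectrum R) < p :=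
    lt_of_le_of_ne hqp (by rintro rfl; exact h1 hyp)
  have h3 := (cd_lt h2).trans (h _ hq.1.2)
  exact (ENat.add_le_add_iff_right (by simp)).1 h3

section fl
variable {L : Type u} [AddCommGroup L] [Module R L] [Module.Finite R L]

theorem pow_le_ann (h : ∀ p : PrimeSpectrum R, Module.annihilator R L ≤ p.asIdeal →
    p.asIdeal = maximalIdeal R) : ∃ n, maximalIdeal R ^ n ≤ Module.annihilator R L := by
  apply Ideal.exists_pow_le_of_le_radical_of_fg
  · rw [Ideal.radical_eq_sInf]
    refine le_sInf fun p hp => ?_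
    exact (h ⟨p, hp.2⟩ hp.1).ge
  · exact IsNoetherian.noetherian _

theorem fl_of (h : ∀ p : PrimeSpectrum R, Module.annihilator R L ≤ p.asIdeal →
    p.asIdeal = maximalIdeal R) : IsFiniteLength R L := by
  rw [isFiniteLength_iff_isNoetherian_isArtinian]
  refine ⟨inferInstance, ?_⟩
  by_cases ht : Module.annihilator R L = ⊤
  · have : Subsingleton L := Module.annihilator_eq_top_iff.1 ht
    infer_instance
  have hA : IsArtinianRing (R ⧸ Module.annihilator R L) := by
    apply IsLocalRing.quotient_artinian_of_mem_minimalPrimes_of_isLocalRing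
    refine ⟨⟨inferInstance, le_maximalIdeal ht⟩, ?_⟩
    rintro q ⟨hq, hq'⟩ _
    exact (h ⟨q, hq⟩ hq').ge
  letI : Module (R ⧸ Module.annihilator R L) L := Module.quotientAnnihilator
  have : IsScalarTower R (R ⧸ Module.annihilator R L) L := inferInstance
  have : Module.Finite (R ⧸ Module.annihilator R L) L := Module.Finite.of_restrictScalars_finite R _ _
  have : IsArtinian (R ⧸ Module.annihilator R L) L := inferInstance
  exact isArtinian_of_surjective_algebraMap (R := R ⧸ Module.annihilator R L) (S := R)
    Ideal.Quotient.mk_surjective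

theorem of_fl (h : IsFiniteLength R L) (p : PrimeSpectrum R) (hp : Module.annihilator R L ≤ p.asIdeal) :
    p.asIdeal = maximalIdeal R := by
  obtain ⟨_, hA⟩ := isFiniteLength_iff_isNoetherian_isArtinian.1 h
  obtain ⟨n, hn⟩ := IsArtinian.monotone_stabilizes (R := R) (M := L)
    ⟨fun n => OrderDual.toDual ((maximalIdeal R ^ n) • (⊤ : Submodule R L)), by
      intro a b hab
      exact Submodule.smul_mono_left (Ideal.pow_le_pow_right hab)⟩
  have h1 : (maximalIdeal R ^ n) • (⊤ : Submodule R L) = (maximalIdeal R ^ (n+1)) • (⊤ : Submodule R L) :=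
    hn (n+1) (by omega)
  have h2 : (maximalIdeal R ^ n) • (⊤ : Submodule R L) = ⊥ := by
    refine Submodule.eq_bot_of_le_smul_of_le_jacobson_bot (maximalIdeal R) _
      (IsNoetherian.noetherian _) ?_ (maximalIdeal_le_jacobson _)
    rw [← mul_smul, ← pow_succ', ← h1]
  have h3 : maximalIdeal R ^ n ≤ p.asIdeal := by
    refine le_trans ?_ hp
    intro r hr
    rw [Module.mem_annihilator]
    intro l
    have := Submodule.smul_mem_smul hr (Submodule.mem_top (x := l))
    rw [h2] at this
    exact this
  exact le_antisymm (le_maximalIdeal p.2.ne_top) (Ideal.IsPrime.le_of_pow_le h3)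

theorem ann_quot (q : Ideal R) (p : PrimeSpectrum R) :
    Module.annihilator R (L ⧸ (q • ⊤ : Submodule R L)) ≤ p.asIdeal ↔
      Module.annihilator R L ≤ p.asIdeal ∧ q ≤ p.asIdeal := by
  have := Module.support_quotient (M := L) q
  have h := Set.ext_iff.1 this p
  rw [Set.mem_inter_iff, Module.mem_support_iff_of_finite, Module.mem_support_iff_of_finite] at h
  exact h

theorem sop_iff {d : ℕ} (x : Fin d → R) : IsSOP R L d x ↔ (∀ i, x i ∈ maximalIdeal R) ∧
    ∀ p : PrimeSpectrum R, Module.annihilator R L ≤ p.asIdeal → (∀ i, x i ∈ p.asIdeal) →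
      p.asIdeal = maximalIdeal R := by
  refine and_congr_right fun _ => ⟨fun h p h1 h2 => ?_, fun h => ?_⟩
  · refine of_fl h p ((ann_quot _ p).2 ⟨h1, ?_⟩)
    rw [Ideal.span_le]
    rintro _ ⟨i, rfl⟩
    exact h2 i
  · refine fl_of fun p hp => ?_
    obtain ⟨h1, h2⟩ := (ann_quot _ p).1 hp
    exact h p h1 fun i => h2 (Ideal.subset_span ⟨i, rfl⟩)

theorem tors_of (h : ∀ p : PrimeSpectrum R, Module.annihilator R L ≤ p.asIdeal →
    p.asIdeal = maximalIdeal R) : Tors L (maximalIdeal R) := by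
  obtain ⟨n, hn⟩ := pow_le_ann h
  intro l
  exact ⟨n, fun r hr => Module.mem_annihilator.1 (hn hr) l⟩

end fl
end
end
end LC
end

section
open CategoryTheory Limits Opposite
namespace LC
noncomputable section
set_option linter.unusedSectionVars false
open IsLocalRing Paper
variable {R : Type u} [CommRing R]

section bid
variable [IsLocalRing R] {L L' : Type u} [AddCommGroup L] [Module R L] [AddCommGroup L'] [Module R L']

theorem mem_b {d : ℕ} {c : R} : c ∈ bIdeal R L d ↔ ∀ x : Fin d → R, IsSOP R L d x → ∀ i, ∀ w : L,
    x i • w ∈ (Ideal.span (x '' {j | j < i}) • ⊤ : Submodule R L) →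
    c • w ∈ (Ideal.span (x '' {j | j < i}) • ⊤ : Submodule R L) := by
  simp only [bIdeal, Submodule.mem_iInf, Module.mem_annihilator]
  refine forall_congr' fun x => forall_congr' fun hx => forall_congr' fun i => ?_
  constructor
  · intro h w hw
    have := h ⟨Submodule.Quotient.mk w, by
      rw [Submodule.mem_torsionBy_iff, ← Submodule.Quotient.mk_smul,
        Submodule.Quotient.mk_eq_zero]; exact hw⟩
    have h2 := congrArg Subtype.val this
    change c • Submodule.Quotient.mk w = 0 at h2
    rw [← Submodule.Quotient.mk_smul, Submodule.Quotient.mk_eq_zero] at h2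
    exact h2
  · rintro h ⟨w, hw⟩
    obtain ⟨w, rfl⟩ := Submodule.Quotient.mk_surjective _ w
    rw [Submodule.mem_torsionBy_iff, ← Submodule.Quotient.mk_smul,
        Submodule.Quotient.mk_eq_zero] at hw
    have := h w hw
    rw [← Submodule.Quotient.mk_eq_zero, Submodule.Quotient.mk_smul] at this
    exact Subtype.ext this

theorem map_smul_top (e : L ≃ₗ[R] L') (q : Ideal R) :
    (q • ⊤ : Submodule R L).map e.toLinearMap = q • ⊤ := by
  rw [Submodule.map_smul'', Submodule.map_top, LinearEquiv.range]

theorem mem_smul_top_iff (e : L ≃ₗ[R] L') (q : Ideal R) (w : L) :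
    e w ∈ (q • ⊤ : Submodule R L') ↔ w ∈ (q • ⊤ : Submodule R L) := by
  rw [← map_smul_top e]
  constructor
  · rintro ⟨v, hv, h⟩
    rw [← e.injective h]; exact hv
  · intro h
    exact ⟨w, h, rfl⟩

theorem sop_congr (e : L ≃ₗ[R] L') {d : ℕ} {x : Fin d → R} (h : IsSOP R L d x) : IsSOP R L' d x :=
  ⟨h.1, (Submodule.Quotient.equiv _ _ e (map_smul_top e _)).isFiniteLength h.2⟩

theorem b_congr (e : L ≃ₗ[R] L') (d : ℕ) : bIdeal R L d ≤ bIdeal R L' d := by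
  intro c hc
  rw [mem_b] at hc ⊢
  intro x hx i w hw
  obtain ⟨w, rfl⟩ := e.surjective w
  rw [← map_smul, mem_smul_top_iff] at hw ⊢
  exact hc x (sop_congr e.symm hx) i w hw

theorem mem_single_smul {a : R} {w : L} :
    w ∈ (Ideal.span {a} • ⊤ : Submodule R L) ↔ ∃ w', w = a • w' := by
  rw [Submodule.ideal_span_singleton_smul, Submodule.mem_smul_pointwise_iff_exists]
  exact ⟨fun ⟨v, _, h⟩ => ⟨v, h.symm⟩, fun ⟨v, h⟩ => ⟨v, trivial, h.symm⟩⟩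

theorem mem_pair_smul {a b : R} {w : L} :
    w ∈ (Ideal.span {a, b} • ⊤ : Submodule R L) ↔ ∃ v v', w = a • v + b • v' := by
  rw [Ideal.span_insert, Submodule.sup_smul, Submodule.mem_sup]
  constructor
  · rintro ⟨y, hy, z, hz, rfl⟩
    obtain ⟨y, rfl⟩ := mem_single_smul.1 hy
    obtain ⟨z, rfl⟩ := mem_single_smul.1 hz
    exact ⟨_, _, rfl⟩
  · rintro ⟨v, v', rfl⟩
    exact ⟨_, mem_single_smul.2 ⟨v, rfl⟩, _, mem_single_smul.2 ⟨v', rfl⟩, rfl⟩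

theorem b_use0 {d : ℕ} {c : R} (hc : c ∈ bIdeal R L (d+1)) {x : Fin (d+1) → R} (hx : IsSOP R L (d+1) x)
    {w : L} (hw : x 0 • w = 0) : c • w = 0 := by
  have := mem_b.1 hc x hx 0 w
  have h0 : x '' {j | j < 0} = ∅ := by simp
  rw [h0, Ideal.span_empty, Submodule.bot_smul] at this
  exact this hw

theorem b_use1 {d : ℕ} {c : R} (hc : c ∈ bIdeal R L (d+2)) {x : Fin (d+2) → R} (hx : IsSOP R L (d+2) x)
    {w w' : L} (hw : x 1 • w = x 0 • w') : ∃ w'', c • w = x 0 • w'' := by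
  have := mem_b.1 hc x hx 1 w
  have h0 : x '' {j | j < 1} = {x 0} := by
    have : {j : Fin (d+2) | j < 1} = {0} := by
      ext j
      simp only [Fin.lt_def, Fin.ext_iff, Set.mem_ofPred_eq, Set.mem_singleton_iff]
      change (j : ℕ) < 1 % (d + 2) ↔ (j : ℕ) = 0
      rw [Nat.mod_eq_of_lt (by omega)]
      omega
    rw [this, Set.image_singleton]
  rw [h0] at this
  exact mem_single_smul.1 (this (mem_single_smul.2 ⟨_, hw⟩))

theorem b_use2 {d : ℕ} {c : R} (hc : c ∈ bIdeal R L (d+3)) {x : Fin (d+3) → R} (hx : IsSOP R L (d+3) x)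
    {w v v' : L} (hw : x 2 • w = x 0 • v + x 1 • v') : ∃ v v', c • w = x 0 • v + x 1 • v' := by
  have := mem_b.1 hc x hx 2 w
  have h0 : x '' {j | j < 2} = {x 0, x 1} := by
    have : {j : Fin (d+3) | j < 2} = {0, 1} := by
      ext j
      simp only [Fin.lt_def, Fin.ext_iff, Set.mem_ofPred_eq, Set.mem_insert_iff, Set.mem_singleton_iff]
      change (j : ℕ) < 2 % (d + 3) ↔ (j : ℕ) = 0 ∨ (j : ℕ) = 1 % (d+3)
      rw [Nat.mod_eq_of_lt (by omega), Nat.mod_eq_of_lt (by omega)]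
      omega
    rw [this, Set.image_pair]
  rw [h0] at this
  exact mem_pair_smul.1 (this (mem_pair_smul.2 ⟨_, _, hw⟩))

end bid

section kill
variable [IsLocalRing R] [IsNoetherianRing R]
variable {L : Type u} [AddCommGroup L] [Module R L] [Module.Finite R L]

local notation "𝔪" => maximalIdeal R

theorem kill0 {y : R} (hy : y ∈ 𝔪) (c : R) (h : ∀ k : ℕ, ∀ w : L, y ^ (k+1) • w = 0 → c • w = 0) :
    ∀ z : H 𝔪 0 L, c • z = 0 := by
  intro z
  apply theta_inj
  rw [map_smul, map_zero]
  obtain ⟨n, hn⟩ := (theta_range 𝔪 (theta 𝔪 L z)).1 ⟨z, rfl⟩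
  apply h n
  rw [pow_succ', mul_smul, hn _ (Ideal.pow_mem_pow hy n), smul_zero]

theorem ann_of_ass {p : Ideal R} (h : p ∈ associatedPrimes R L) :
    p.IsPrime ∧ ∃ w : L, ∀ r, r ∈ p ↔ r • w = 0 := by
  obtain ⟨h1, w, rfl⟩ := isAssociatedPrime_iff.1 h
  exact ⟨h1, w, fun r => by rw [Submodule.mem_colon_singleton, Submodule.mem_bot]⟩

theorem reg_of {y : R} (h : ∀ p ∈ associatedPrimes R L, y ∉ p) :
    Function.Injective (y • (LinearMap.id : L →ₗ[R] L)) := by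
  rw [injective_iff_map_eq_zero]
  intro w hw
  by_contra h0
  obtain ⟨p, hp, hle⟩ := exists_le_isAssociatedPrime_of_isNoetherianRing R w h0
  exact h p hp (hle (by rw [Submodule.mem_colon_singleton, Submodule.mem_bot]; exact hw))

theorem not_ass (h0 : Subsingleton (H 𝔪 0 L)) : 𝔪 ∉ associatedPrimes R L := by
  intro h
  obtain ⟨h1, w, hw⟩ := ann_of_ass h
  obtain ⟨z, hz⟩ := (theta_range 𝔪 w).2 ⟨1, fun r hr => by
    rw [pow_one] at hr
    exact (hw r).1 hr⟩
  rw [Subsingleton.elim z 0, map_zero] at hz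
  apply h1.ne_top
  rw [Ideal.eq_top_iff_one, hw, ← hz, smul_zero]

theorem H0_quot {y : R} (hreg : Function.Injective (y • (LinearMap.id : L →ₗ[R] L)))
    (h0 : Subsingleton (H 𝔪 0 L)) (h1 : Subsingleton (H 𝔪 1 L)) : Subsingleton (H 𝔪 0 (L ⧸ Px y L)) := by
  refine subsingleton_of_forall_eq 0 fun z => ?_
  obtain ⟨w, rfl⟩ := (H_exact₃ 𝔪 0 (ses_inj hreg) z).1 (Subsingleton.elim _ _)
  rw [Subsingleton.elim w 0, map_zero]

theorem sub_quot_pow_zero (y : R) : Subsingleton (L ⧸ Px (y ^ 0) L) := by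
  refine subsingleton_of_forall_eq 0 fun w => ?_
  obtain ⟨w, rfl⟩ := Submodule.Quotient.mk_surjective _ w
  rw [Submodule.Quotient.mk_eq_zero]
  exact ⟨w, by simp⟩

theorem mk_eq_zero_iff {y : R} {w : L} :
    (Submodule.Quotient.mk w : L ⧸ Px y L) = 0 ↔ ∃ w', w = y • w' := by
  rw [Submodule.Quotient.mk_eq_zero]
  exact ⟨fun ⟨v, h⟩ => ⟨v, h.symm⟩, fun ⟨v, h⟩ => ⟨v, h.symm⟩⟩

theorem mk_eq_iff {y : R} {w v : L} :
    (Submodule.Quotient.mk w : L ⧸ Px y L) = Submodule.Quotient.mk v ↔ ∃ w', w = v + y • w' := by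
  rw [← sub_eq_zero, ← Submodule.Quotient.mk_sub, mk_eq_zero_iff]
  exact exists_congr fun a => sub_eq_iff_eq_add'

theorem kill1 (h0 : Subsingleton (H 𝔪 0 L))
    (hd : ∀ p : PrimeSpectrum R, Module.annihilator R L ≤ p.asIdeal → cd p ≤ 2) (c : R)
    (hc : ∀ y : Fin 2 → R, IsSOP R L 2 y → ∀ w w' : L, y 1 • w = y 0 • w' → ∃ w'', c • w = y 0 • w'') :
    ∀ z : H 𝔪 1 L, c • z = 0 := by
  have hmm : ∀ n : ℕ, ∀ p : PrimeSpectrum R, 𝔪 ≤ p.asIdeal → cd p ≤ n := fun n p hp => by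
    rw [cd_max (le_antisymm (le_maximalIdeal p.2.ne_top) hp)]; exact bot_le
  obtain ⟨y, hy, hyF, hyd⟩ := exists_step (Module.annihilator R L) 𝔪 1 (by simpa [one_add_one_eq_two] using hd) (hmm 1)
    (associatedPrimes R L) (associatedPrimes.finite R L) (fun p hp => hp.1) (fun p hp hle => by
      have : p = 𝔪 := le_antisymm (le_maximalIdeal hp.1.ne_top) hle
      exact not_ass h0 (this ▸ hp))
  obtain ⟨t, ht, -, htd⟩ := exists_step (Module.annihilator R L ⊔ Ideal.span {y}) 𝔪 0 (by
      intro p hp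
      rw [sup_le_iff, Ideal.span_singleton_le_iff_mem] at hp
      simpa using hyd p hp.1 hp.2) (hmm 0) ∅ Set.finite_empty (by simp) (by simp)
  refine H_kill_of_quot 𝔪 hy c (reg_of hyF) 0 ?_
  intro n
  rcases n with _ | n
  · have := sub_quot_pow_zero (L := L) y
    have := H_subsing_of_subsing 𝔪 0 (M := L ⧸ Px (y ^ 0) L)
    intro z
    exact Subsingleton.elim _ _
  refine kill0 ht c ?_
  intro k w hw
  obtain ⟨w, rfl⟩ := Submodule.Quotient.mk_surjective _ w
  rw [← Submodule.Quotient.mk_smul, mk_eq_zero_iff] at hw ⊢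
  obtain ⟨w', hw⟩ := hw
  refine hc ![y ^ (n+1), t ^ (k+1)] ?_ w w' hw
  rw [sop_iff]
  constructor
  · intro i
    fin_cases i
    · exact Ideal.pow_mem_of_mem _ hy _ (by omega)
    · exact Ideal.pow_mem_of_mem _ ht _ (by omega)
  · intro p hp hi
    have h1 : y ∈ p.asIdeal := p.2.mem_of_pow_mem _ (hi 0)
    have h2 : t ∈ p.asIdeal := p.2.mem_of_pow_mem _ (hi 1)
    refine cd_zero ?_
    refine htd p ?_ h2
    rw [sup_le_iff, Ideal.span_singleton_le_iff_mem]
    exact ⟨hp, h1⟩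

theorem ann_Px {y : R} {p : PrimeSpectrum R} (h : Module.annihilator R (L ⧸ Px y L) ≤ p.asIdeal) :
    Module.annihilator R L ≤ p.asIdeal ∧ y ∈ p.asIdeal := by
  constructor
  · refine le_trans ?_ h
    intro r hr
    rw [Module.mem_annihilator] at hr ⊢
    intro w
    obtain ⟨w, rfl⟩ := Submodule.Quotient.mk_surjective _ w
    rw [← Submodule.Quotient.mk_smul, hr, Submodule.Quotient.mk_zero]
  · apply h
    rw [Module.mem_annihilator]
    intro w
    obtain ⟨w, rfl⟩ := Submodule.Quotient.mk_surjective _ w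
    rw [← Submodule.Quotient.mk_smul, mk_eq_zero_iff]
    exact ⟨w, rfl⟩

theorem ann_le_Px (y : R) : Module.annihilator R L ≤ Module.annihilator R (L ⧸ Px y L) := by
  intro r hr
  rw [Module.mem_annihilator] at hr ⊢
  intro w
  obtain ⟨w, rfl⟩ := Submodule.Quotient.mk_surjective _ w
  rw [← Submodule.Quotient.mk_smul, hr, Submodule.Quotient.mk_zero]

theorem reg_pow {y : R} (hreg : Function.Injective (y • (LinearMap.id : L →ₗ[R] L))) (n : ℕ) :
    Function.Injective (y ^ n • (LinearMap.id : L →ₗ[R] L)) := by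
  induction n with
  | zero => intro a b; simp
  | succ n ih =>
    intro a b h
    apply ih
    apply hreg
    simp only [LinearMap.smul_apply, LinearMap.id_apply] at h ⊢
    rw [← mul_smul, ← mul_smul, ← pow_succ', h]

theorem kill2 (h0 : Subsingleton (H 𝔪 0 L)) (h1 : Subsingleton (H 𝔪 1 L)) {a : R} (ha : a ∈ 𝔪)
    (hreg : Function.Injective (a • (LinearMap.id : L →ₗ[R] L)))
    (hd : ∀ p : PrimeSpectrum R, Module.annihilator R L ≤ p.asIdeal → a ∈ p.asIdeal → cd p ≤ 2) (c : R)
    (hc : c ∈ bIdeal R L 3) :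
    ∀ z : H 𝔪 2 L, c • z = 0 := by
  refine H_kill_of_quot 𝔪 ha c hreg 1 ?_
  intro n
  rcases n with _ | n
  · have := sub_quot_pow_zero (L := L) a
    have := H_subsing_of_subsing 𝔪 1 (M := L ⧸ Px (a ^ 0) L)
    intro z
    exact Subsingleton.elim _ _
  refine kill1 (H0_quot (reg_pow hreg _) h0 h1) ?_ c ?_
  · intro p hp
    have := ann_Px hp
    exact hd p this.1 (p.2.mem_of_pow_mem _ this.2)
  · intro y hy w w' hw
    rw [sop_iff] at hy
    obtain ⟨w, rfl⟩ := Submodule.Quotient.mk_surjective _ w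
    obtain ⟨w', rfl⟩ := Submodule.Quotient.mk_surjective _ w'
    rw [← Submodule.Quotient.mk_smul, ← Submodule.Quotient.mk_smul, mk_eq_iff] at hw
    obtain ⟨v, hv⟩ := hw
    obtain ⟨v, v', hv⟩ := b_use2 (d := 0) hc (x := ![a ^ (n+1), y 0, y 1]) (by
      rw [sop_iff]
      constructor
      · intro i
        fin_cases i
        · exact Ideal.pow_mem_of_mem _ ha _ (by omega)
        · exact hy.1 0
        · exact hy.1 1
      · intro p hp hi
        refine hy.2 p ?_ ?_
        · have e := (ann_quot (L := L) (Ideal.span {a ^ (n+1)}) p).2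
            ⟨hp, by rw [Ideal.span_singleton_le_iff_mem]; exact hi 0⟩
          refine le_trans ?_ e
          intro r hr
          rw [Module.mem_annihilator] at hr ⊢
          intro w
          obtain ⟨w, rfl⟩ := Submodule.Quotient.mk_surjective _ w
          rw [← Submodule.Quotient.mk_smul, Submodule.Quotient.mk_eq_zero, mem_single_smul,
            ← mk_eq_zero_iff, Submodule.Quotient.mk_smul]
          exact hr _
        · intro i
          fin_cases i
          · exact hi 1
          · exact hi 2) (w := w) (v := v) (v' := w') (by
        change y 1 • w = a ^ (n+1) • v + y 0 • w'
        rw [hv, add_comm])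
    refine ⟨Submodule.Quotient.mk v', ?_⟩
    rw [← Submodule.Quotient.mk_smul, ← Submodule.Quotient.mk_smul, mk_eq_iff]
    refine ⟨v, ?_⟩
    rw [add_comm]
    exact hv

end kill
end
end LC
end

section
open CategoryTheory Limits Opposite
namespace LC
noncomputable section
set_option linter.unusedSectionVars false
open IsLocalRing Paper
variable {R : Type u} [CommRing R]

section
variable [IsLocalRing R] [IsNoetherianRing R]

local notation "𝔪" => maximalIdeal R

theorem cube_mem {I : Ideal R} {x : R} (hx : x ∈ I ^ 3) (hm : x ∈ 𝔪) : x ∈ I * (I ⊓ 𝔪) := by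
  by_cases h : I = ⊤
  · subst h
    rw [top_inf_eq, Ideal.top_mul]
    exact hm
  · rw [inf_eq_left.2 (le_maximalIdeal h), ← pow_two]
    exact Ideal.pow_le_pow_right (by omega) hx

theorem cube_mem' {I : Ideal R} {x : R} (hx : x ∈ I ^ 3) : x ∈ I := by
  have := Ideal.pow_le_pow_right (I := I) (m := 1) (n := 3) (by omega) hx
  rwa [pow_one] at this

variable {M : Type u} [AddCommGroup M] [Module R M] [Module.Finite R M]

theorem H0_of_reg {y : R} (hy : y ∈ 𝔪) (hreg : ∀ w : M, y • w = 0 → w = 0) : Subsingleton (H 𝔪 0 M) := by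
  refine subsingleton_of_forall_eq 0 fun z => ?_
  have := kill0 hy 1 (L := M) (by
    intro k
    induction k with
    | zero =>
      intro w hw
      rw [zero_add, pow_one] at hw
      rw [hreg w hw, smul_zero]
    | succ k ih =>
      intro w hw
      apply ih
      rw [pow_succ', mul_smul] at hw
      exact hreg _ hw) z
  rwa [one_smul] at this

theorem H1_of_reg {y : R} (hy : y ∈ 𝔪) (hreg : Function.Injective (y • (LinearMap.id : M →ₗ[R] M)))
    (h0 : Subsingleton (H 𝔪 0 (M ⧸ Px y M))) : Subsingleton (H 𝔪 1 M) := by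
  have e3 := Hmap_inj_of' 𝔪 (ses_inj hreg) 0
  refine subsingleton_of_forall_eq 0 fun z => ?_
  obtain ⟨n, hn⟩ := H_tors 𝔪 1 M z
  have h := hn _ (pow_mem_pow' 𝔪 hy n)
  clear hn
  induction n with
  | zero => simpa using h
  | succ n ih =>
    apply ih
    apply e3
    rw [Hmap_smul_id, ← mul_smul, ← pow_succ', h, map_zero]

theorem exists_reg_of_depth {n : ℕ} (h : ((n + 1 : ℕ) : WithTop ℕ) ≤ depth R M) :
    ∃ rs : List R, n + 1 ≤ rs.length ∧ (∀ r ∈ rs, r ∈ 𝔪) ∧ RingTheory.Sequence.IsRegular M rs := by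
  by_contra hcon
  push Not at hcon
  have : depth R M ≤ (n : WithTop ℕ) := by
    refine sSup_le ?_
    rintro _ ⟨rs, rfl, h1, h2⟩
    by_contra h3
    refine hcon rs ?_ h1 h2
    have h4 : n < rs.length := by exact_mod_cast not_le.1 h3
    omega
  have h5 : n + 1 ≤ n := by exact_mod_cast h.trans this
  omega

theorem reg_one (h : (1 : WithTop ℕ) ≤ depth R M) :
    ∃ y ∈ 𝔪, ∀ w : M, y • w = 0 → w = 0 := by
  obtain ⟨rs, h1, h2, h3⟩ := exists_reg_of_depth (n := 0) (M := M) (by simpa using h)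
  match rs, h1 with
  | y :: rs, _ =>
    have h4 := h3.1
    rw [RingTheory.Sequence.isWeaklyRegular_cons_iff] at h4
    refine ⟨y, h2 y (by simp), fun w hw => h4.1 ?_⟩
    simpa using hw

theorem reg_two (h : (2 : WithTop ℕ) ≤ depth R M) :
    ∃ y ∈ 𝔪, ∃ t ∈ 𝔪, (∀ w : M, y • w = 0 → w = 0) ∧
      ∀ w w' : M, t • w = y • w' → ∃ w'', w = y • w'' := by
  obtain ⟨rs, h1, h2, h3⟩ := exists_reg_of_depth (n := 1) (M := M) (by simpa [one_add_one_eq_two] using h)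
  match rs, h1 with
  | y :: t :: rs, _ =>
    have h4 := h3.1
    rw [RingTheory.Sequence.isWeaklyRegular_cons_iff, RingTheory.Sequence.isWeaklyRegular_cons_iff] at h4
    refine ⟨y, h2 y (by simp), t, h2 t (by simp), fun w hw => h4.1 (by simpa using hw), ?_⟩
    intro w w' hw
    have h5 : ∀ v : M, (Submodule.Quotient.mk v : QuotSMulTop y M) = 0 ↔ ∃ v', v = y • v' := by
      intro v
      rw [Submodule.Quotient.mk_eq_zero, Submodule.mem_smul_pointwise_iff_exists]
      exact ⟨fun ⟨v, _, h⟩ => ⟨v, h.symm⟩, fun ⟨v, h⟩ => ⟨v, trivial, h.symm⟩⟩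
    rw [← h5]
    apply h4.2.1
    change t • (Submodule.Quotient.mk w : QuotSMulTop y M) = t • 0
    rw [smul_zero, ← Submodule.Quotient.mk_smul, h5]
    exact ⟨w', hw⟩

theorem H01_of_depth (h : (2 : WithTop ℕ) ≤ depth R M) :
    Subsingleton (H 𝔪 0 M) ∧ Subsingleton (H 𝔪 1 M) := by
  obtain ⟨y, hy, t, ht, h1, h2⟩ := reg_two h
  refine ⟨H0_of_reg hy h1, H1_of_reg hy ?_ ?_⟩
  · rw [injective_iff_map_eq_zero]
    exact h1
  · refine H0_of_reg ht ?_
    intro w hw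
    obtain ⟨w, rfl⟩ := Submodule.Quotient.mk_surjective _ w
    rw [← Submodule.Quotient.mk_smul, mk_eq_zero_iff] at hw
    obtain ⟨w', hw⟩ := hw
    rw [mk_eq_zero_iff]
    exact h2 w w' hw

theorem stepM (a : R) (ha : a ∈ 𝔪)
    (hd : ∀ p : PrimeSpectrum R, Module.annihilator R M ≤ p.asIdeal → a ∈ p.asIdeal → cd p ≤ 2)
    (h0 : Subsingleton (H 𝔪 0 M)) (h1 : Subsingleton (H 𝔪 1 M))
    (hreg : Function.Injective (a • (LinearMap.id : M →ₗ[R] M)))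
    (hba : a ∈ bIdeal R M 3 ^ 3) :
    sl 𝔪 (H 𝔪 1 (M ⧸ Px a M)) = sl 𝔪 (H 𝔪 2 M) ∧
    sl 𝔪 (H 𝔪 2 (M ⧸ Px a M)) = sl 𝔪 (H 𝔪 2 M) + sl 𝔪 (H 𝔪 3 M) := by
  have hk : ∀ c ∈ bIdeal R M 3, ∀ z : H 𝔪 2 M, c • z = 0 := fun c hc => kill2 h0 h1 ha hreg hd c hc
  have hU : Ux a M = ⊥ := LinearMap.ker_eq_bot.2 hreg
  have hUs : Subsingleton (Ux a M) := by rw [hU]; infer_instance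
  have hH : ∀ i, Subsingleton (H 𝔪 i (Ux a M)) := fun i => H_subsing_of_subsing 𝔪 i
  constructor
  · rw [split_low 𝔪 a (bIdeal R M 3) 1 (cube_mem' hba) hk (hH 3) h1]
    exact sl_congr 𝔪 (Hequiv 𝔪 2 (Submodule.quotEquivOfEqBot _ hU))
  · refine split 𝔪 a (bIdeal R M 3) 2 (cube_mem hba ha) ?_ hk (hH 3) (hH 4)
    intro c _ n hn
    have : n = 0 := hreg (by rw [map_zero]; exact hn)
    rw [this, smul_zero]

theorem ann_sub_le (U : Submodule R M) : Module.annihilator R M ≤ Module.annihilator R U := by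
  intro r hr
  rw [Module.mem_annihilator] at hr ⊢
  intro w
  exact Subtype.ext (hr _)

theorem mem_ann_Ux (b : R) : b ∈ Module.annihilator R (Ux b M) := by
  rw [Module.mem_annihilator]
  intro w
  exact Subtype.ext w.2

theorem stepN (b c : R) (hb : b ∈ 𝔪) (hc : c ∈ 𝔪)
    (hsop : ∀ p : PrimeSpectrum R, Module.annihilator R M ≤ p.asIdeal → b ∈ p.asIdeal →
      c ∈ p.asIdeal → p.asIdeal = 𝔪)
    (hd : ∀ p : PrimeSpectrum R, Module.annihilator R M ≤ p.asIdeal → cd p ≤ 2)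
    (h0 : Subsingleton (H 𝔪 0 M))
    (hbb : b ∈ bIdeal R M 2 ^ 3) :
    sl 𝔪 (H 𝔪 1 (M ⧸ Px b M)) = sl 𝔪 (H 𝔪 1 M) + sl 𝔪 (H 𝔪 2 M) ∧
    sl 𝔪 (H 𝔪 0 (M ⧸ Px b M)) = sl 𝔪 (H 𝔪 1 (M ⧸ Ux b M)) := by
  have hk : ∀ c ∈ bIdeal R M 2, ∀ z : H 𝔪 1 M, c • z = 0 := fun c hc =>
    kill1 h0 hd c fun y hy w w' hw => b_use1 (d := 0) hc hy hw
  have hs : IsSOP R M 2 ![b, c] := by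
    rw [sop_iff]
    refine ⟨fun i => ?_, fun p hp hi => hsop p hp (hi 0) (hi 1)⟩
    fin_cases i
    · exact hb
    · exact hc
  have hH : ∀ i, Subsingleton (H 𝔪 (i + 2) (Ux b M)) := by
    intro i
    refine H_zero_of_tors_quot 𝔪 hc (tors_of ?_) (tors_of ?_) i
    · intro p hp
      refine hsop p ?_ ?_ ?_
      · exact ((ann_sub_le _).trans (ann_sub_le _)).trans hp
      · exact hp (ann_sub_le _ (mem_ann_Ux b))
      · exact hp (mem_ann_Ux c)
    · intro p hp
      have := ann_Px hp
      exact hsop p ((ann_sub_le _).trans this.1) (this.1 (mem_ann_Ux b)) this.2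
  constructor
  · exact split 𝔪 b (bIdeal R M 2) 1 (cube_mem hbb hb)
      (fun c hc n hn => b_use0 (d := 1) hc hs hn) hk (hH 0) (hH 1)
  · exact split_low 𝔪 b (bIdeal R M 2) 0 (cube_mem' hbb) hk (hH 0) h0

theorem stepP (c : R) (hc : c ∈ 𝔪)
    (hsop : ∀ p : PrimeSpectrum R, Module.annihilator R M ≤ p.asIdeal →
      c ∈ p.asIdeal → p.asIdeal = 𝔪)
    (hbc : c ∈ bIdeal R M 1 ^ 3) :
    sl 𝔪 (H 𝔪 0 (M ⧸ Px c M)) = sl 𝔪 (H 𝔪 0 M) + sl 𝔪 (H 𝔪 1 M) := by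
  have hs : ∀ k : ℕ, IsSOP R M 1 ![c ^ (k+1)] := by
    intro k
    rw [sop_iff]
    refine ⟨fun i => ?_, fun p hp hi => hsop p hp (p.2.mem_of_pow_mem _ (hi 0))⟩
    fin_cases i
    exact Ideal.pow_mem_of_mem _ hc _ (by omega)
  have ht : Tors (Ux c M) 𝔪 := tors_of fun p hp =>
    hsop p ((ann_sub_le _).trans hp) (hp (mem_ann_Ux c))
  refine split 𝔪 c (bIdeal R M 1) 0 (cube_mem hbc hc) ?_ ?_ (H_tors_zero 𝔪 0 _ ht) (H_tors_zero 𝔪 1 _ ht)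
  · intro r hr n hn
    refine b_use0 (d := 0) hr (hs 0) ?_
    simpa using hn
  · intro r hr
    exact kill0 hc r fun k w hw => b_use0 (d := 0) hr (hs k) hw

/-- The main additivity computation. -/
theorem main_sum (a b c : R) (ha : a ∈ 𝔪) (hb : b ∈ 𝔪) (hc : c ∈ 𝔪)
    (hsop : ∀ p : PrimeSpectrum R, Module.annihilator R M ≤ p.asIdeal → a ∈ p.asIdeal → b ∈ p.asIdeal →
      c ∈ p.asIdeal → p.asIdeal = 𝔪)
    (h0 : Subsingleton (H 𝔪 0 M)) (h1 : Subsingleton (H 𝔪 1 M))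
    (hreg : Function.Injective (a • (LinearMap.id : M →ₗ[R] M)))
    (hba : a ∈ bIdeal R M 3 ^ 3) (hbb : b ∈ bIdeal R (M ⧸ Px a M) 2 ^ 3)
    (hbc : c ∈ bIdeal R ((M ⧸ Px a M) ⧸ Px b (M ⧸ Px a M)) 1 ^ 3) :
    sl 𝔪 (H 𝔪 0 (((M ⧸ Px a M) ⧸ Px b (M ⧸ Px a M)) ⧸ Px c ((M ⧸ Px a M) ⧸ Px b (M ⧸ Px a M)))) =
      2 * sl 𝔪 (H 𝔪 2 M) + sl 𝔪 (H 𝔪 3 M) +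
        sl 𝔪 (H 𝔪 1 ((M ⧸ Px a M) ⧸ Ux b (M ⧸ Px a M))) := by
  have hd : ∀ p : PrimeSpectrum R, Module.annihilator R M ≤ p.asIdeal → a ∈ p.asIdeal → cd p ≤ 2 := by
    classical
    intro p hp hap
    refine (cd_le_card p {b, c} ?_ ?_).trans (by exact_mod_cast Finset.card_le_two)
    · intro q hq hs
      exact hsop q (hp.trans hq) (hq hap) (hs b (by simp)) (hs c (by simp))
    · intro t ht
      rcases Finset.mem_insert.1 ht with rfl | ht
      · exact hb
      · rw [Finset.mem_singleton.1 ht]; exact hc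
  obtain ⟨e1, e2⟩ := stepM a ha hd h0 h1 hreg hba
  obtain ⟨e3, e4⟩ := stepN b c hb hc (fun p hp => by
    have := ann_Px hp
    exact hsop p this.1 this.2) (fun p hp => by
    have := ann_Px hp
    exact hd p this.1 this.2) (H0_quot hreg h0 h1) hbb
  have e5 := stepP c hc (fun p hp => by
    have t1 := ann_Px hp
    have t2 := ann_Px t1.1
    exact hsop p t2.1 t2.2 t1.2) hbc
  rw [e5, e4, e3, e2, e1, two_mul]
  ring

end
end
end LC
end

section
open CategoryTheory Limits Opposite
open IsLocalRing Paper
set_option linter.unusedSectionVars false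
namespace LC
noncomputable section
variable {R : Type u} [CommRing R]

section loc
theorem le_one_of {x : WithBot (WithTop ℕ)} (h : ¬ 2 ≤ x) : x ≤ ((1 : WithTop ℕ) : WithBot (WithTop ℕ)) := by
  induction x with
  | bot => exact bot_le
  | coe x =>
    refine WithBot.coe_le_coe.2 ?_
    have h : ¬ (2 : WithTop ℕ) ≤ x := fun h' => h (WithBot.coe_le_coe.2 h')
    induction x with
    | top => exact absurd le_top h
    | coe x =>
      have h : ¬ 2 ≤ x := fun h' => h (WithTop.coe_le_coe.2 h')
      have : x ≤ 1 := by omega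
      exact WithTop.coe_le_coe.2 this

theorem le_zero_of {x : WithBot (WithTop ℕ)} (h : ¬ 1 ≤ x) (y : WithTop ℕ) : x ≤ (y : WithBot (WithTop ℕ)) := by
  induction x with
  | bot => exact bot_le
  | coe x =>
    refine WithBot.coe_le_coe.2 ?_
    have h : ¬ (1 : WithTop ℕ) ≤ x := fun h' => h (WithBot.coe_le_coe.2 h')
    induction x with
    | top => exact absurd le_top h
    | coe x =>
      have h : ¬ 1 ≤ x := fun h' => h (WithTop.coe_le_coe.2 h')
      have : x = 0 := by omega
      subst this
      exact bot_le

variable {L : Type u} [AddCommGroup L] [Module R L]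

/-- contraction of a prime of the localization -/
def ctr {p : PrimeSpectrum R} (Q : PrimeSpectrum (Localization.AtPrime p.asIdeal)) : PrimeSpectrum R :=
  PrimeSpectrum.comap (algebraMap R (Localization.AtPrime p.asIdeal)) Q

theorem mem_ctr {p : PrimeSpectrum R} (Q : PrimeSpectrum (Localization.AtPrime p.asIdeal)) (r : R) :
    r ∈ (ctr Q).asIdeal ↔ algebraMap R (Localization.AtPrime p.asIdeal) r ∈ Q.asIdeal := Iff.rfl

theorem ctr_le {p : PrimeSpectrum R} {Q Q' : PrimeSpectrum (Localization.AtPrime p.asIdeal)} :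
    ctr Q ≤ ctr Q' ↔ Q ≤ Q' := by
  refine ⟨fun h z hz => ?_, fun h r hr => h hr⟩
  obtain ⟨r, s, rfl⟩ := IsLocalization.exists_mk'_eq p.asIdeal.primeCompl z
  rw [IsLocalization.mk'_mem_iff] at hz ⊢
  exact h hz

theorem ctr_lt {p : PrimeSpectrum R} {Q Q' : PrimeSpectrum (Localization.AtPrime p.asIdeal)} :
    ctr Q < ctr Q' ↔ Q < Q' := by
  rw [lt_iff_le_not_ge, lt_iff_le_not_ge, ctr_le, ctr_le]

theorem ctr_le_p {p : PrimeSpectrum R} (Q : PrimeSpectrum (Localization.AtPrime p.asIdeal)) : ctr Q ≤ p := by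
  intro r hr
  by_contra hp
  refine Q.2.ne_top (Ideal.eq_top_of_isUnit_mem _ hr ?_)
  exact IsLocalization.map_units (Localization.AtPrime p.asIdeal) (⟨r, hp⟩ : p.asIdeal.primeCompl)

theorem ann_ctr {p : PrimeSpectrum R} (Q : PrimeSpectrum (Localization.AtPrime p.asIdeal))
    (h : Module.annihilator (Localization.AtPrime p.asIdeal) (LocalizedModule p.asIdeal.primeCompl L) ≤ Q.asIdeal) :
    Module.annihilator R L ≤ (ctr Q).asIdeal := by
  intro r hr
  refine h ?_
  rw [Module.mem_annihilator] at hr ⊢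
  intro z
  induction z using LocalizedModule.induction_on with
  | h m s =>
    rw [algebraMap_smul, LocalizedModule.smul'_mk, hr, LocalizedModule.zero_mk]

theorem exists_ctr [Module.Finite R L] {p q : PrimeSpectrum R} (hqp : q ≤ p) (h : Module.annihilator R L ≤ q.asIdeal) :
    ∃ Q : PrimeSpectrum (Localization.AtPrime p.asIdeal), ctr Q = q ∧
      Module.annihilator (Localization.AtPrime p.asIdeal) (LocalizedModule p.asIdeal.primeCompl L) ≤ Q.asIdeal := by
  have h1 : q ∈ Set.range (PrimeSpectrum.comap (algebraMap R (Localization.AtPrime p.asIdeal))) := by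
    rw [PrimeSpectrum.localization_comap_range _ p.asIdeal.primeCompl]
    exact Set.disjoint_left.2 fun r hr hr' => hr (hqp hr')
  obtain ⟨Q, rfl⟩ := h1
  refine ⟨Q, rfl, ?_⟩
  have h2 : (PrimeSpectrum.comap (algebraMap R (Localization.AtPrime p.asIdeal)) Q) ∈ Module.support R L := by
    rw [Module.support_eq_zeroLocus]
    exact h
  obtain ⟨m, hm⟩ := Module.mem_support_iff_exists_annihilator.1 h2
  intro z hz
  obtain ⟨r, s, rfl⟩ := IsLocalization.exists_mk'_eq p.asIdeal.primeCompl z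
  rw [IsLocalization.mk'_mem_iff]
  rw [Module.mem_annihilator] at hz
  have h3 := hz (LocalizedModule.mk m 1)
  rw [← Localization.mk_eq_mk', LocalizedModule.mk_smul_mk, ← LocalizedModule.zero_mk 1, LocalizedModule.mk_eq] at h3
  obtain ⟨t, ht⟩ := h3
  have h4 : t.1 * r ∈ (R ∙ m).annihilator := by
    rw [Submodule.mem_annihilator_span_singleton, mul_smul]
    have h5 : t.1 • r • m = t.1 • (0 : L) := by simpa [Submonoid.smul_def] using ht
    rw [h5, smul_zero]
  rcases (ctr Q).2.mem_or_mem (hm h4) with h5 | h5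
  · exact absurd (ctr_le_p Q h5) t.2
  · exact h5

theorem dim1 [Module.Finite R L] {p q0 q1 : PrimeSpectrum R} (h0 : Module.annihilator R L ≤ q0.asIdeal)
    (h01 : q0 < q1) (h1 : q1 ≤ p) :
    1 ≤ mdim (Localization.AtPrime p.asIdeal) (LocalizedModule p.asIdeal.primeCompl L) := by
  obtain ⟨Q0, rfl, hQ0⟩ := exists_ctr (h01.le.trans h1) h0
  obtain ⟨Q1, rfl, hQ1⟩ := exists_ctr h1 (h0.trans h01.le)
  have e1 := cd_lt (ctr_lt.1 h01)
  have e2 := cd_le_dim Q0 hQ0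
  have e3 : (1 : ℕ∞) ≤ cd Q0 := le_trans (by simp) e1
  refine le_trans ?_ e2
  exact WithBot.coe_le_coe.2 e3

theorem dim2 [Module.Finite R L] {p q0 q1 q2 : PrimeSpectrum R} (h0 : Module.annihilator R L ≤ q0.asIdeal)
    (h01 : q0 < q1) (h12 : q1 < q2) (h2 : q2 ≤ p) :
    2 ≤ mdim (Localization.AtPrime p.asIdeal) (LocalizedModule p.asIdeal.primeCompl L) := by
  obtain ⟨Q0, rfl, hQ0⟩ := exists_ctr ((h01.trans h12).le.trans h2) h0
  obtain ⟨Q1, rfl, hQ1⟩ := exists_ctr (h12.le.trans h2) (h0.trans h01.le)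
  obtain ⟨Q2, rfl, hQ2⟩ := exists_ctr h2 (h0.trans (h01.trans h12).le)
  have e0 := cd_lt (ctr_lt.1 h12)
  have e1 := cd_lt (ctr_lt.1 h01)
  have e2 := cd_le_dim Q0 hQ0
  have e3 : (2 : ℕ∞) ≤ cd Q0 := by
    refine le_trans ?_ e1
    rw [← one_add_one_eq_two]
    exact add_le_add_left (le_trans (by simp) e0) 1
  refine le_trans ?_ e2
  exact WithBot.coe_le_coe.2 e3

theorem chain1 (h : 1 ≤ mdim R L) : ∃ q0 q1 : PrimeSpectrum R,
    Module.annihilator R L ≤ q0.asIdeal ∧ q0 < q1 := by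
  rw [mdim, ringKrullDim_quotient] at h
  obtain ⟨l, hl⟩ := (Order.le_krullDim_iff (n := 1)).1 h
  refine ⟨(l ⟨0, by omega⟩).1, (l ⟨1, by omega⟩).1, (l ⟨0, by omega⟩).2, ?_⟩
  exact l.strictMono (Fin.mk_lt_mk.2 (by omega))

theorem chain2 (h : 2 ≤ mdim R L) : ∃ q0 q1 q2 : PrimeSpectrum R,
    Module.annihilator R L ≤ q0.asIdeal ∧ q0 < q1 ∧ q1 < q2 := by
  rw [mdim, ringKrullDim_quotient] at h
  obtain ⟨l, hl⟩ := (Order.le_krullDim_iff (n := 2)).1 h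
  refine ⟨(l ⟨0, by omega⟩).1, (l ⟨1, by omega⟩).1, (l ⟨2, by omega⟩).1, (l ⟨0, by omega⟩).2, ?_, ?_⟩
  · exact l.strictMono (Fin.mk_lt_mk.2 (by omega))
  · exact l.strictMono (Fin.mk_lt_mk.2 (by omega))

variable [IsNoetherianRing R] [Module.Finite R L]

theorem ass_ctr {p : PrimeSpectrum R} (Q : PrimeSpectrum (Localization.AtPrime p.asIdeal))
    (h : Q.asIdeal ∈ associatedPrimes (Localization.AtPrime p.asIdeal) (LocalizedModule p.asIdeal.primeCompl L)) :
    (ctr Q).asIdeal ∈ associatedPrimes R L :=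
  Module.associatedPrimes.comap_mem_associatedPrimes_of_mem_associatedPrimes_of_isLocalizedModule_of_fg
    p.asIdeal.primeCompl (LocalizedModule.mkLinearMap p.asIdeal.primeCompl L) _ h (IsNoetherian.noetherian _)

/-- a module all of whose associated primes are minimal has positive depth if positive dimension -/
theorem depth_one [IsLocalRing R] [Nontrivial L] (h : maximalIdeal R ∉ associatedPrimes R L) :
    1 ≤ depth R L := by
  obtain ⟨y, hy, hyp⟩ := avoid (maximalIdeal R) (associatedPrimes R L) (associatedPrimes.finite R L)
    (fun p hp => hp.isPrime) (fun p hp hle => by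
      have := hp.isPrime
      exact h (le_antisymm hle (le_maximalIdeal this.ne_top) ▸ hp))
  refine le_sSup ⟨[y], by simp, by simpa using hy, ?_⟩
  refine RingTheory.Sequence.IsRegular.of_isWeaklyRegular_of_mem_maximalIdeal L (by simpa using hy) ?_
  rw [RingTheory.Sequence.isWeaklyRegular_singleton_iff]
  exact reg_of hyp

theorem s2_loc (hass : ∀ q : PrimeSpectrum R, q.asIdeal ∈ associatedPrimes R L →
      ¬ ∃ q0 : PrimeSpectrum R, Module.annihilator R L ≤ q0.asIdeal ∧ q0 < q)
    (p : PrimeSpectrum R) (hp : ¬ ∃ q0 q1 q2 : PrimeSpectrum R, Module.annihilator R L ≤ q0.asIdeal ∧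
      q0 < q1 ∧ q1 < q2 ∧ q2 ≤ p) :
    IsS2 (Localization.AtPrime p.asIdeal) (LocalizedModule p.asIdeal.primeCompl L) := by
  intro P hP
  by_cases h2 : 2 ≤ mdim (Localization.AtPrime P.asIdeal)
    (LocalizedModule P.asIdeal.primeCompl (LocalizedModule p.asIdeal.primeCompl L))
  · exfalso
    obtain ⟨Q0, Q1, Q2, e0, e1, e2⟩ := chain2 h2
    exact hp ⟨ctr (ctr Q0), ctr (ctr Q1), ctr (ctr Q2), ann_ctr _ (ann_ctr _ e0), ctr_lt.2 (ctr_lt.2 e1),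
      ctr_lt.2 (ctr_lt.2 e2), ctr_le_p _⟩
  by_cases h1 : 1 ≤ mdim (Localization.AtPrime P.asIdeal)
    (LocalizedModule P.asIdeal.primeCompl (LocalizedModule p.asIdeal.primeCompl L))
  · have hnt : Nontrivial (LocalizedModule P.asIdeal.primeCompl (LocalizedModule p.asIdeal.primeCompl L)) := hP
    have h3 := depth_one (R := Localization.AtPrime P.asIdeal)
      (L := LocalizedModule P.asIdeal.primeCompl (LocalizedModule p.asIdeal.primeCompl L)) (by
      intro hm
      obtain ⟨Q0, Q1, e0, e1⟩ := chain1 h1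
      have e2 : Q0 < closedPoint _ := lt_of_lt_of_le e1 (le_maximalIdeal Q1.2.ne_top)
      exact hass (ctr (ctr (closedPoint _))) (ass_ctr _ (ass_ctr _ hm))
        ⟨ctr (ctr Q0), ann_ctr _ (ann_ctr _ e0), ctr_lt.2 (ctr_lt.2 e2)⟩)
    refine le_trans ?_ (WithBot.coe_le_coe.2 h3)
    exact (min_le_right _ _).trans (le_one_of h2)
  · exact (min_le_right _ _).trans (le_zero_of h1 _)
end loc
end
end LC
end

section
open CategoryTheory Limits Opposite
open IsLocalRing Paper
set_option linter.unusedSectionVars false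
namespace LC
noncomputable section
variable {R : Type u} [CommRing R]

section spart
variable {M S : Type u} [AddCommGroup M] [Module R M] [AddCommGroup S] [Module R S]

theorem surj_use (ι : M →ₗ[R] S) (p : Ideal R) [p.IsPrime]
    (h : Function.Surjective (IsLocalizedModule.map p.primeCompl
        (LocalizedModule.mkLinearMap p.primeCompl M)
        (LocalizedModule.mkLinearMap p.primeCompl S) ι)) (s : S) :
    ∃ u ∉ p, ∃ m, u • s = ι m := by
  obtain ⟨z, hz⟩ := h (LocalizedModule.mkLinearMap p.primeCompl S s)
  obtain ⟨⟨m, t⟩, rfl⟩ := IsLocalizedModule.mk'_surjective p.primeCompl (LocalizedModule.mkLinearMap p.primeCompl M) z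
  rw [Function.uncurry_apply_pair, IsLocalizedModule.map_mk', ← IsLocalizedModule.mk'_one p.primeCompl (LocalizedModule.mkLinearMap p.primeCompl S) s,
    IsLocalizedModule.mk'_eq_mk'_iff] at hz
  obtain ⟨v, hv⟩ := hz
  refine ⟨(v * t).1, (v * t).2, v.1 • m, ?_⟩
  rw [one_smul] at hv
  simp only [Submonoid.smul_def] at hv
  rw [Submonoid.coe_mul, mul_smul, map_smul]
  first | exact hv | exact hv.symm

theorem exists_not_ann [Module.Finite R S] (p : PrimeSpectrum R) (hp : Module.annihilator R S ≤ p.asIdeal) :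
    ∃ s : S, ∀ u : R, u • s = 0 → u ∈ p.asIdeal := by
  have h : p ∈ Module.support R S := by
    rw [Module.support_eq_zeroLocus]
    exact hp
  obtain ⟨s, hs⟩ := Module.mem_support_iff_exists_annihilator.1 h
  exact ⟨s, fun u hu => hs ((Submodule.mem_annihilator_span_singleton _ _).2 hu)⟩

variable [IsLocalRing R] [IsNoetherianRing R] [Module.Finite R M] [Module.Finite R S]

local notation "𝔪" => maximalIdeal R

theorem no_below (hM3 : ∀ p : PrimeSpectrum R, Module.annihilator R M ≤ p.asIdeal → cd p ≤ 3)
    (q : PrimeSpectrum R) (hq : cd q = 3) : 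
    ¬ ∃ q0 : PrimeSpectrum R, Module.annihilator R M ≤ q0.asIdeal ∧ q0 < q := by
  rintro ⟨q0, h0, h1⟩
  have h2 := cd_lt h1
  rw [hq] at h2
  have h3 := h2.trans (hM3 q0 h0)
  revert h3
  norm_num

theorem supp_W (ι : M →ₗ[R] S) (hM3 : ∀ p : PrimeSpectrum R, Module.annihilator R M ≤ p.asIdeal → cd p ≤ 3)
    (hass : ∀ p : PrimeSpectrum R, p.asIdeal ∈ associatedPrimes R M → cd p = 3)
    (hm : Module.annihilator R M ≤ 𝔪)
    (hsurj : ∀ (p : Ideal R) [p.IsPrime], p ≠ maximalIdeal R →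
      IsS2 (Localization.AtPrime p) (LocalizedModule p.primeCompl M) →
      Function.Surjective (IsLocalizedModule.map p.primeCompl
        (LocalizedModule.mkLinearMap p.primeCompl M)
        (LocalizedModule.mkLinearMap p.primeCompl S) ι))
    (p : PrimeSpectrum R) (hp : Module.annihilator R (S ⧸ LinearMap.range ι) ≤ p.asIdeal) :
    Module.annihilator R M ≤ p.asIdeal ∧ cd p ≤ 1 := by
  by_cases hpm : p.asIdeal = 𝔪
  · rw [cd_max hpm, hpm]
    exact ⟨hm, by simp⟩
  by_cases hch : ∃ q0 q1 q2 : PrimeSpectrum R, Module.annihilator R M ≤ q0.asIdeal ∧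
      q0 < q1 ∧ q1 < q2 ∧ q2 ≤ p
  · obtain ⟨q0, q1, q2, h0, h1, h2, h3⟩ := hch
    refine ⟨h0.trans ((h1.trans h2).le.trans h3), ?_⟩
    have e0 := hM3 q0 h0
    have e1 := cd_lt h1
    have e2 := cd_lt h2
    have e3 := cd_mono h3
    have e4 : cd p + 1 + 1 ≤ 3 := by
      refine le_trans ?_ (e1.trans e0)
      gcongr
      refine le_trans ?_ e2
      gcongr
    have e5 : cd p ≠ ⊤ := by
      intro h
      rw [h] at e4
      simp at e4
    obtain ⟨n, hn⟩ := ENat.ne_top_iff_exists.1 e5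
    rw [← hn] at e4 ⊢
    have : n + 1 + 1 ≤ 3 := by exact_mod_cast e4
    have : n ≤ 1 := by omega
    exact_mod_cast this
  · exfalso
    have h1 := hsurj p.asIdeal hpm (s2_loc (fun q hq => no_below hM3 q (hass q hq)) p hch)
    obtain ⟨w, hw⟩ := exists_not_ann p hp
    obtain ⟨s, rfl⟩ := Submodule.Quotient.mk_surjective _ w
    obtain ⟨u, hu, m, hm⟩ := surj_use ι p.asIdeal h1 s
    refine hu (hw u ?_)
    rw [← Submodule.Quotient.mk_smul, Submodule.Quotient.mk_eq_zero, hm]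
    exact ⟨m, rfl⟩

theorem ann_S_le (ι : M →ₗ[R] S) (hι : Function.Injective ι) : Module.annihilator R S ≤ Module.annihilator R M := by
  intro r hr
  rw [Module.mem_annihilator] at hr ⊢
  intro m
  apply hι
  rw [map_smul, hr, map_zero]

theorem supp_S (ι : M →ₗ[R] S) 
    (hW : ∀ p : PrimeSpectrum R, Module.annihilator R (S ⧸ LinearMap.range ι) ≤ p.asIdeal → 
      Module.annihilator R M ≤ p.asIdeal ∧ cd p ≤ 1) (p : PrimeSpectrum R)
    (hp : Module.annihilator R S ≤ p.asIdeal) : Module.annihilator R M ≤ p.asIdeal := by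
  have h : Module.annihilator R M * Module.annihilator R (S ⧸ LinearMap.range ι) ≤ p.asIdeal := by
    refine le_trans ?_ hp
    rw [Ideal.mul_le]
    intro r hr t ht
    rw [Module.mem_annihilator] at *
    intro s
    have h1 := ht (Submodule.Quotient.mk s)
    rw [← Submodule.Quotient.mk_smul, Submodule.Quotient.mk_eq_zero] at h1
    obtain ⟨m, hm⟩ := h1
    rw [mul_smul, ← hm, ← map_smul, hr, map_zero]
  rcases p.2.mul_le.1 h with h | h
  · exact h
  · exact (hW p h).1

theorem loc_kill {p : PrimeSpectrum R} (w : S) (hw : ∀ r ∈ p.asIdeal, r • w = 0)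
    (Y : Localization.AtPrime p.asIdeal) (hY : Y ∈ maximalIdeal (Localization.AtPrime p.asIdeal)) :
    Y • (LocalizedModule.mk w 1 : LocalizedModule p.asIdeal.primeCompl S) = 0 := by
  obtain ⟨r, s, rfl⟩ := IsLocalization.exists_mk'_eq p.asIdeal.primeCompl Y
  rw [IsLocalization.AtPrime.mk'_mem_maximal_iff (Localization.AtPrime p.asIdeal) p.asIdeal] at hY
  rw [← Localization.mk_eq_mk', LocalizedModule.mk_smul_mk, hw r hY, LocalizedModule.zero_mk]

theorem mk_one_zero {p : PrimeSpectrum R} (w : S)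
    (h : (LocalizedModule.mk w 1 : LocalizedModule p.asIdeal.primeCompl S) = 0) : ∃ u ∉ p.asIdeal, u • w = 0 := by
  rw [← LocalizedModule.zero_mk 1, LocalizedModule.mk_eq] at h
  obtain ⟨t, ht⟩ := h
  refine ⟨t.1, t.2, ?_⟩
  simpa [Submonoid.smul_def] using ht

theorem ass_S (hS : IsS2 R S) (p : PrimeSpectrum R) (hp : p.asIdeal ∈ associatedPrimes R S) :
    ¬ ∃ q0 : PrimeSpectrum R, Module.annihilator R S ≤ q0.asIdeal ∧ q0 < p := by
  rintro ⟨q0, h0, h1⟩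
  have h2 := dim1 h0 h1 le_rfl
  obtain ⟨_, w, hw⟩ := ann_of_ass hp
  have h3 := hS p (by
    rw [Module.support_eq_zeroLocus]
    exact h0.trans h1.le)
  have h4 : (1 : WithTop ℕ) ≤ depth (Localization.AtPrime p.asIdeal) (LocalizedModule p.asIdeal.primeCompl S) := by
    refine WithBot.coe_le_coe.1 (le_trans (le_min ?_ h2) h3)
    exact one_le_two
  obtain ⟨Y, hY, hreg⟩ := reg_one h4
  obtain ⟨u, hu, hu'⟩ := mk_one_zero (p := p) w (hreg _ (loc_kill w (fun r hr => (hw r).1 hr) Y hY))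
  exact hu ((hw u).2 hu')

theorem cd_ass_S (ι : M →ₗ[R] S) (hι : Function.Injective ι)
    (hass : ∀ p : PrimeSpectrum R, p.asIdeal ∈ associatedPrimes R M → cd p = 3)
    (hW : ∀ p : PrimeSpectrum R, Module.annihilator R (S ⧸ LinearMap.range ι) ≤ p.asIdeal → 
      Module.annihilator R M ≤ p.asIdeal ∧ cd p ≤ 1) (p : PrimeSpectrum R)
    (hp : Module.annihilator R S ≤ p.asIdeal)
    (hno : ¬ ∃ q0 : PrimeSpectrum R, Module.annihilator R S ≤ q0.asIdeal ∧ q0 < p) : cd p = 3 := by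
  refine hass p (Module.associatedPrimes.minimalPrimes_annihilator_subset_associatedPrimes R M ?_)
  refine ⟨⟨p.2, supp_S ι hW p hp⟩, ?_⟩
  rintro J ⟨hJ, hJ'⟩ hle
  by_contra hnle
  exact hno ⟨⟨J, hJ⟩, (ann_S_le ι hι).trans hJ', lt_of_le_not_ge hle hnle⟩

theorem reg_S (ι : M →ₗ[R] S) (hι : Function.Injective ι)
    (hass : ∀ p : PrimeSpectrum R, p.asIdeal ∈ associatedPrimes R M → cd p = 3)
    (hW : ∀ p : PrimeSpectrum R, Module.annihilator R (S ⧸ LinearMap.range ι) ≤ p.asIdeal → 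
      Module.annihilator R M ≤ p.asIdeal ∧ cd p ≤ 1) (hS : IsS2 R S) (y : R)
    (hy : ∀ p : PrimeSpectrum R, Module.annihilator R M ≤ p.asIdeal → y ∈ p.asIdeal → cd p ≤ 2) :
    Function.Injective (y • (LinearMap.id : S →ₗ[R] S)) := by
  refine reg_of fun p hp hyp => ?_
  have hpp := hp.isPrime
  have h1 : Module.annihilator R S ≤ p := by
    have := hp.annihilator_le
    rwa [Submodule.annihilator_top] at this
  have h2 := cd_ass_S ι hι hass hW ⟨p, hpp⟩ h1 (ass_S hS _ hp)
  have h3 := hy ⟨p, hpp⟩ (supp_S ι hW _ h1) hyp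
  rw [h2] at h3
  revert h3
  norm_num

end spart
end
end LC
end

section
open CategoryTheory Limits Opposite
open IsLocalRing Paper
set_option linter.unusedSectionVars false
namespace LC
noncomputable section
variable {R : Type u} [CommRing R]

section vpart
variable {M S : Type u} [AddCommGroup M] [Module R M] [AddCommGroup S] [Module R S]
variable [IsLocalRing R] [IsNoetherianRing R] [Module.Finite R M] [Module.Finite R S]

local notation "𝔪" => maximalIdeal R

theorem cd_of_m (n : ℕ) (p : PrimeSpectrum R) (hp : 𝔪 ≤ p.asIdeal) : cd p ≤ n := by
  rw [cd_max (le_antisymm (le_maximalIdeal p.2.ne_top) hp)]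
  exact bot_le

theorem cd_zero' {p : PrimeSpectrum R} (h : cd p ≤ ((0 : ℕ) : ℕ∞)) : p.asIdeal = 𝔪 := cd_zero h

theorem H2W (W : Type u) [AddCommGroup W] [Module R W] [Module.Finite R W]
    (hW : ∀ p : PrimeSpectrum R, Module.annihilator R W ≤ p.asIdeal → cd p ≤ 1) :
    Subsingleton (H 𝔪 2 W) := by
  obtain ⟨t, ht, -, h⟩ := exists_step (Module.annihilator R W) 𝔪 0 (fun p hp => by simpa using hW p hp)
    (cd_of_m 0) ∅ Set.finite_empty (by simp) (by simp)
  refine H_zero_of_tors_quot 𝔪 ht (tors_of fun p hp => ?_) (tors_of fun p hp => ?_) 0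
  · refine cd_zero' (h p ((ann_sub_le _).trans hp) (hp ?_))
    exact mem_ann_Ux t
  · have := ann_Px hp
    exact cd_zero' (h p this.1 this.2)

/-- killing ideal -/
theorem inf_cd (ι : M →ₗ[R] S)
    (hW : ∀ p : PrimeSpectrum R, Module.annihilator R (S ⧸ LinearMap.range ι) ≤ p.asIdeal → 
      Module.annihilator R M ≤ p.asIdeal ∧ cd p ≤ 1) (n : ℕ) (p : PrimeSpectrum R)
    (hp : Module.annihilator R (S ⧸ LinearMap.range ι) ⊓ 𝔪 ≤ p.asIdeal) : cd p ≤ (n + 1 : ℕ) := by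
  rcases p.2.inf_le.1 hp with h | h
  · exact (hW p h).2.trans (by simp)
  · exact cd_of_m _ p h

theorem kill_W (ι : M →ₗ[R] S) (y : R) (hy : y ∈ Module.annihilator R (S ⧸ LinearMap.range ι)) (s : S) :
    ∃ m, y • s = ι m := by
  rw [Module.mem_annihilator] at hy
  have := hy (Submodule.Quotient.mk s)
  rw [← Submodule.Quotient.mk_smul, Submodule.Quotient.mk_eq_zero] at this
  obtain ⟨m, hm⟩ := this
  exact ⟨m, hm.symm⟩

theorem b_kill_W (ι : M →ₗ[R] S) (hι : Function.Injective ι)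
    (hM3 : ∀ p : PrimeSpectrum R, Module.annihilator R M ≤ p.asIdeal → cd p ≤ 3)
    (hass : ∀ p : PrimeSpectrum R, p.asIdeal ∈ associatedPrimes R M → cd p = 3)
    (hW : ∀ p : PrimeSpectrum R, Module.annihilator R (S ⧸ LinearMap.range ι) ≤ p.asIdeal → 
      Module.annihilator R M ≤ p.asIdeal ∧ cd p ≤ 1) (hS : IsS2 R S) (c : R)
    (hc : c ∈ bIdeal R M 3) (s : S) : ∃ m, c • s = ι m := by
  obtain ⟨y1, hy1, -, h1⟩ := exists_step (Module.annihilator R M)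
    (Module.annihilator R (S ⧸ LinearMap.range ι) ⊓ 𝔪) 2 (fun p hp => by
      refine (hM3 p hp).trans ?_
      norm_num) (inf_cd ι hW 1) ∅ Set.finite_empty (by simp) (by simp)
  obtain ⟨y2, hy2, -, h2⟩ := exists_step (Module.annihilator R M ⊔ Ideal.span {y1})
    (Module.annihilator R (S ⧸ LinearMap.range ι) ⊓ 𝔪) 1 (fun p hp => by
      refine (h1 p (le_sup_left.trans hp) (hp (Ideal.mem_sup_right (Ideal.mem_span_singleton_self _)))).trans ?_
      norm_num) (inf_cd ι hW 0) ∅ Set.finite_empty (by simp) (by simp)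
  obtain ⟨y3, hy3, -, h3⟩ := exists_step (Module.annihilator R M ⊔ Ideal.span {y1} ⊔ Ideal.span {y2}) 𝔪 0 
    (fun p hp => by
      refine (h2 p (le_sup_left.trans hp) (hp (Ideal.mem_sup_right (Ideal.mem_span_singleton_self _)))).trans ?_
      norm_num) (cd_of_m 0) ∅ Set.finite_empty (by simp) (by simp)
  have hsop : IsSOP R M 3 ![y1, y2, y3] := by
    rw [sop_iff]
    constructor
    · intro i
      fin_cases i
      · exact hy1.2
      · exact hy2.2
      · exact hy3
    · intro p hp hx
      refine cd_zero' (h3 p ?_ (hx 2))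
      refine sup_le (sup_le hp ?_) ?_
      · exact (Ideal.span_singleton_le_iff_mem _).2 (hx 0)
      · exact (Ideal.span_singleton_le_iff_mem _).2 (hx 1)
  obtain ⟨m1, hm1⟩ := kill_W ι y1 hy1.1 s
  obtain ⟨m2, hm2⟩ := kill_W ι y2 hy2.1 s
  obtain ⟨m3, hm3⟩ := b_use1 hc hsop (w := m1) (w' := m2) (by
    apply hι
    change ι (y2 • m1) = ι (y1 • m2)
    rw [map_smul, map_smul, ← hm1, ← hm2, smul_comm])
  refine ⟨m3, reg_S ι hι hass hW hS y1 h1 ?_⟩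
  change y1 • c • s = y1 • ι m3
  rw [smul_comm, hm1, ← map_smul, ← map_smul, hm3]
  rfl

theorem back (ι : M →ₗ[R] S) (hι : Function.Injective ι)
    (hW : ∀ p : PrimeSpectrum R, Module.annihilator R (S ⧸ LinearMap.range ι) ≤ p.asIdeal → 
      Module.annihilator R M ≤ p.asIdeal ∧ cd p ≤ 1) (a b : R)
    (hd : ∀ p : PrimeSpectrum R, Module.annihilator R M ≤ p.asIdeal → a ∈ p.asIdeal → cd p ≤ 2)
    (hbb : b ∈ bIdeal R (M ⧸ Px a M) 2) (m : M) (s : S) (h : ι m = a • s) : ∃ m', b • m = a • m' := by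
  obtain ⟨y2, hy2, -, h2⟩ := exists_step (Module.annihilator R M ⊔ Ideal.span {a})
    (Module.annihilator R (S ⧸ LinearMap.range ι) ⊓ 𝔪) 1 (fun p hp => by
      refine (hd p (le_sup_left.trans hp) (hp (Ideal.mem_sup_right (Ideal.mem_span_singleton_self _)))).trans ?_
      norm_num) (inf_cd ι hW 0) ∅ Set.finite_empty (by simp) (by simp)
  obtain ⟨y3, hy3, -, h3⟩ := exists_step (Module.annihilator R M ⊔ Ideal.span {a} ⊔ Ideal.span {y2}) 𝔪 0 
    (fun p hp => by
      refine (h2 p (le_sup_left.trans hp) (hp (Ideal.mem_sup_right (Ideal.mem_span_singleton_self _)))).trans ?_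
      norm_num) (cd_of_m 0) ∅ Set.finite_empty (by simp) (by simp)
  have hsop : IsSOP R (M ⧸ Px a M) 2 ![y2, y3] := by
    rw [sop_iff]
    constructor
    · intro i
      fin_cases i
      · exact hy2.2
      · exact hy3
    · intro p hp hx
      obtain ⟨hp1, hp2⟩ := ann_Px hp
      refine cd_zero' (h3 p ?_ (hx 1))
      refine sup_le (sup_le hp1 ?_) ?_
      · exact (Ideal.span_singleton_le_iff_mem _).2 hp2
      · exact (Ideal.span_singleton_le_iff_mem _).2 (hx 0)
  obtain ⟨m2, hm2⟩ := kill_W ι y2 hy2.1 s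
  have := b_use0 hbb hsop (w := Submodule.Quotient.mk m) (by
    change y2 • (Submodule.Quotient.mk m : M ⧸ Px a M) = 0
    rw [← Submodule.Quotient.mk_smul, mk_eq_zero_iff]
    refine ⟨m2, hι ?_⟩
    rw [map_smul, map_smul, h, ← hm2, smul_comm])
  rwa [← Submodule.Quotient.mk_smul, mk_eq_zero_iff] at this

theorem depth_case (p : PrimeSpectrum R) (a : R) (hreg : Function.Injective (a • (LinearMap.id : S →ₗ[R] S)))
    (s0 : S) (hs0 : ∀ r, r ∈ p.asIdeal ↔ ∃ s, r • s0 = a • s)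
    (hdep : (2 : WithTop ℕ) ≤ depth (Localization.AtPrime p.asIdeal) (LocalizedModule p.asIdeal.primeCompl S)) :
    False := by
  have hA : ∀ z : LocalizedModule p.asIdeal.primeCompl S, a • z = 0 → z = 0 := by
    intro z hz
    induction z using LocalizedModule.induction_on with
    | h s t =>
      rw [LocalizedModule.smul'_mk, ← LocalizedModule.zero_mk 1, LocalizedModule.mk_eq] at hz
      obtain ⟨v, hv⟩ := hz
      rw [← LocalizedModule.zero_mk 1, LocalizedModule.mk_eq]
      refine ⟨v, ?_⟩
      simp only [Submonoid.smul_def, smul_zero, one_smul] at hv ⊢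
      refine hreg ?_
      change a • v.1 • s = a • 0
      rw [smul_comm, hv, smul_zero]
  have hA' : ∀ z z' : LocalizedModule p.asIdeal.primeCompl S, a • z = a • z' → z = z' := fun z z' h =>
    sub_eq_zero.1 (hA _ (by rw [smul_sub, h, sub_self]))
  have hmax : ∀ Y ∈ maximalIdeal (Localization.AtPrime p.asIdeal), ∃ σ : LocalizedModule p.asIdeal.primeCompl S,
      Y • LocalizedModule.mk s0 1 = a • σ := by
    intro Y hY
    obtain ⟨r, t, rfl⟩ := IsLocalization.exists_mk'_eq p.asIdeal.primeCompl Y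
    rw [IsLocalization.AtPrime.mk'_mem_maximal_iff (Localization.AtPrime p.asIdeal) p.asIdeal] at hY
    obtain ⟨s, hs⟩ := (hs0 r).1 hY
    refine ⟨LocalizedModule.mk s t, ?_⟩
    rw [← Localization.mk_eq_mk', LocalizedModule.mk_smul_mk, hs, mul_one, LocalizedModule.smul'_mk]
  obtain ⟨α, hα, β, hβ, h1, h2⟩ := reg_two hdep
  obtain ⟨σ, hσ⟩ := hmax α hα
  obtain ⟨τ, hτ⟩ := hmax β hβ
  obtain ⟨ρ, hρ⟩ := h2 σ τ (by
    apply hA'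
    rw [smul_comm a β, ← hσ, smul_comm a α, ← hτ, smul_comm])
  have h3 : (LocalizedModule.mk s0 1 : LocalizedModule p.asIdeal.primeCompl S) = a • ρ := by
    refine sub_eq_zero.1 (h1 _ ?_)
    rw [smul_sub, hσ, hρ, smul_comm, sub_self]
  induction ρ using LocalizedModule.induction_on with
  | h s t =>
    rw [LocalizedModule.smul'_mk, LocalizedModule.mk_eq] at h3
    obtain ⟨v, hv⟩ := h3
    refine (v * t).2 ((hs0 _).2 ⟨v.1 • s, ?_⟩)
    simp only [Submonoid.smul_def, one_smul] at hv
    rw [Submonoid.coe_mul, mul_smul, hv, smul_comm]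

theorem forth (ι : M →ₗ[R] S) (hι : Function.Injective ι)
    (hass : ∀ p : PrimeSpectrum R, p.asIdeal ∈ associatedPrimes R M → cd p = 3)
    (hW : ∀ p : PrimeSpectrum R, Module.annihilator R (S ⧸ LinearMap.range ι) ≤ p.asIdeal → 
      Module.annihilator R M ≤ p.asIdeal ∧ cd p ≤ 1) (hS : IsS2 R S) (a b c : R)
    (ha : a ∈ 𝔪) (hb : b ∈ 𝔪) (hc : c ∈ 𝔪)
    (hsop : ∀ p : PrimeSpectrum R, Module.annihilator R M ≤ p.asIdeal → a ∈ p.asIdeal → b ∈ p.asIdeal →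
      c ∈ p.asIdeal → p.asIdeal = 𝔪)
    (hd : ∀ p : PrimeSpectrum R, Module.annihilator R M ≤ p.asIdeal → a ∈ p.asIdeal → cd p ≤ 2)
    (hba : a ∈ bIdeal R M 3) (m m' : M) (h : b • m = a • m') : ∃ s, ι m = a • s := by
  by_contra hcon
  have hregS := reg_S ι hι hass hW hS a hd
  let U : Submodule R M := Submodule.comap ι (LinearMap.range (a • (LinearMap.id : S →ₗ[R] S)))
  have hU : ∀ w : M, (Submodule.Quotient.mk w : M ⧸ U) = 0 ↔ ∃ s, ι w = a • s := by
    intro w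
    rw [Submodule.Quotient.mk_eq_zero]
    exact ⟨fun ⟨v, h⟩ => ⟨v, h.symm⟩, fun ⟨v, h⟩ => ⟨v, h.symm⟩⟩
  obtain ⟨P, hP, hle⟩ := exists_le_isAssociatedPrime_of_isNoetherianRing R
    (Submodule.Quotient.mk m : M ⧸ U) (fun h0 => hcon ((hU m).1 h0))
  have hle' : ∀ r : R, (∃ s, ι (r • m) = a • s) → r ∈ P := by
    intro r hr
    apply hle
    rw [Submodule.mem_colon_singleton, Submodule.mem_bot, ← Submodule.Quotient.mk_smul, hU]
    exact hr
  have haP : a ∈ P := hle' a ⟨ι m, by rw [map_smul]⟩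
  have hbP : b ∈ P := hle' b ⟨ι m', by rw [h, map_smul]⟩
  obtain ⟨hPp, w, hw⟩ := ann_of_ass hP
  obtain ⟨m0, rfl⟩ := Submodule.Quotient.mk_surjective _ w
  have hs0 : ∀ r, r ∈ P ↔ ∃ s, r • ι m0 = a • s := by
    intro r
    rw [hw, ← Submodule.Quotient.mk_smul, hU, map_smul]
  let p : PrimeSpectrum R := ⟨P, hPp⟩
  have hSp : Module.annihilator R S ≤ p.asIdeal := by
    intro r hr
    rw [Module.mem_annihilator] at hr
    exact (hs0 r).2 ⟨0, by rw [hr, smul_zero]⟩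
  by_cases h2 : 2 ≤ mdim (Localization.AtPrime p.asIdeal) (LocalizedModule p.asIdeal.primeCompl S)
  · refine depth_case p a hregS (ι m0) hs0 ?_
    have h3 := hS p (by
      rw [Module.support_eq_zeroLocus]
      exact hSp)
    exact WithBot.coe_le_coe.1 (le_trans (le_min le_rfl h2) h3)
  have hmin : ∀ J : PrimeSpectrum R, Module.annihilator R S ≤ J.asIdeal → a ∈ J.asIdeal → ¬ J < p := by
    intro J hJ haJ hlt
    have h3 : ∃ q0 : PrimeSpectrum R, Module.annihilator R S ≤ q0.asIdeal ∧ q0 < J := by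
      by_contra hno
      have h4 := cd_ass_S ι hι hass hW J hJ hno
      have h5 := hd J (supp_S ι hW J hJ) haJ
      rw [h4] at h5
      revert h5
      norm_num
    obtain ⟨q0, h4, h5⟩ := h3
    exact h2 (dim2 h4 h5 hlt le_rfl)
  have hex : ∃ u ∉ P, ∃ n : ℕ, u * b ^ n ∈ Module.annihilator R S ⊔ Ideal.span {a ^ 2} := by
    by_contra hno
    push Not at hno
    obtain ⟨J, hJ, hIJ, hdis⟩ := Ideal.exists_le_prime_disjoint (Module.annihilator R S ⊔ Ideal.span {a ^ 2})
      (P.primeCompl ⊔ Submonoid.powers b) (by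
        refine Set.disjoint_left.2 fun r hr hr' => ?_
        obtain ⟨z, hz, u, ⟨n, rfl⟩, rfl⟩ := Submonoid.mem_sup.1 hr'
        exact hno z hz n hr)
    have hJP : J ≤ P := by
      intro r hr
      by_contra hrP
      exact Set.disjoint_left.1 hdis hr (Submonoid.mem_sup_left hrP)
    refine hmin ⟨J, hJ⟩ (le_sup_left.trans hIJ)
      (hJ.mem_of_pow_mem 2 (hIJ (Ideal.mem_sup_right (Ideal.mem_span_singleton_self _)))) (lt_of_le_not_ge hJP ?_)
    intro hPJ
    exact Set.disjoint_left.1 hdis (hPJ hbP) (Submonoid.mem_sup_right (Submonoid.mem_powers b))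
  obtain ⟨u, hu, n, hun⟩ := hex
  obtain ⟨e, he, f, hf, hef⟩ := Submodule.mem_sup.1 hun
  obtain ⟨r, rfl⟩ := Ideal.mem_span_singleton'.1 hf
  have he' := Module.mem_annihilator.1 (ann_S_le ι hι he) m0
  have hsop' : IsSOP R M 3 ![a ^ 2, b ^ (n + 1), c] := by
    rw [sop_iff]
    constructor
    · intro i
      fin_cases i
      · exact Ideal.pow_mem_of_mem _ ha 2 (by norm_num)
      · exact Ideal.pow_mem_of_mem _ hb (n + 1) (by omega)
      · exact hc
    · intro q hq hx
      exact hsop q hq (q.2.mem_of_pow_mem 2 (hx 0)) (q.2.mem_of_pow_mem (n + 1) (hx 1)) (hx 2)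
  obtain ⟨m3, hm3⟩ := b_use1 hba hsop' (w := u • m0) (w' := (b * r) • m0) (by
    change b ^ (n + 1) • u • m0 = a ^ 2 • (b * r) • m0
    have : b ^ (n + 1) * u = b * e + a ^ 2 * (b * r) := by
      linear_combination (-b) * hef
    rw [← mul_smul, this, add_smul, mul_smul, he', smul_zero, zero_add, mul_smul])
  refine hu ((hs0 u).2 ⟨ι m3, hregS ?_⟩)
  change a • u • ι m0 = a • a • ι m3
  rw [← map_smul, ← map_smul, hm3, ← map_smul, ← map_smul, ← mul_smul, ← pow_two]
  rfl

theorem final_S (ι : M →ₗ[R] S) (hι : Function.Injective ι)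
    (hM3 : ∀ p : PrimeSpectrum R, Module.annihilator R M ≤ p.asIdeal → cd p ≤ 3)
    (hass : ∀ p : PrimeSpectrum R, p.asIdeal ∈ associatedPrimes R M → cd p = 3)
    (hW : ∀ p : PrimeSpectrum R, Module.annihilator R (S ⧸ LinearMap.range ι) ≤ p.asIdeal → 
      Module.annihilator R M ≤ p.asIdeal ∧ cd p ≤ 1) (hS : IsS2 R S) (a b c : R)
    (ha : a ∈ 𝔪) (hb : b ∈ 𝔪) (hc : c ∈ 𝔪)
    (hsop : ∀ p : PrimeSpectrum R, Module.annihilator R M ≤ p.asIdeal → a ∈ p.asIdeal → b ∈ p.asIdeal →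
      c ∈ p.asIdeal → p.asIdeal = 𝔪)
    (hd : ∀ p : PrimeSpectrum R, Module.annihilator R M ≤ p.asIdeal → a ∈ p.asIdeal → cd p ≤ 2)
    (h0 : Subsingleton (H 𝔪 0 M)) (h1 : Subsingleton (H 𝔪 1 M))
    (hreg : Function.Injective (a • (LinearMap.id : M →ₗ[R] M)))
    (hba : a ∈ bIdeal R M 3) (hbb : b ∈ bIdeal R (M ⧸ Px a M) 2) :
    sl 𝔪 (H 𝔪 1 ((M ⧸ Px a M) ⧸ Ux b (M ⧸ Px a M))) = sl 𝔪 (H 𝔪 2 S) := by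
  have hregS := reg_S ι hι hass hW hS a hd
  let g : S →ₗ[R] M := (LinearEquiv.ofInjective ι hι).symm.toLinearMap ∘ₗ
    (a • (LinearMap.id : S →ₗ[R] S)).codRestrict (LinearMap.range ι) (fun s => by
      obtain ⟨m, hm⟩ := b_kill_W ι hι hM3 hass hW hS a hba s
      exact ⟨m, hm.symm⟩)
  have hg : ∀ s, ι (g s) = a • s := by
    intro s
    have := (LinearEquiv.ofInjective ι hι).apply_symm_apply
      ((a • (LinearMap.id : S →ₗ[R] S)).codRestrict (LinearMap.range ι) (fun s => by
      obtain ⟨m, hm⟩ := b_kill_W ι hι hM3 hass hW hS a hba s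
      exact ⟨m, hm.symm⟩) s)
    exact congrArg Subtype.val this
  have hginj : Function.Injective g := by
    intro s s' h
    apply hregS
    change a • s = a • s'
    rw [← hg, ← hg, h]
  let φ : M →ₗ[R] ((M ⧸ Px a M) ⧸ Ux b (M ⧸ Px a M)) := (Ux b (M ⧸ Px a M)).mkQ ∘ₗ (Px a M).mkQ
  have hφ : Function.Surjective φ := (Submodule.mkQ_surjective _).comp (Submodule.mkQ_surjective _)
  have hker : LinearMap.range g = LinearMap.ker φ := by
    ext m
    have e1 : m ∈ LinearMap.ker φ ↔ ∃ m', b • m = a • m' := by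
      rw [← mk_eq_zero_iff, Submodule.Quotient.mk_smul, LinearMap.mem_ker]
      change (Submodule.Quotient.mk (Submodule.Quotient.mk m) : (M ⧸ Px a M) ⧸ Ux b (M ⧸ Px a M)) = 0 ↔ _
      rw [Submodule.Quotient.mk_eq_zero]
      exact Iff.rfl
    rw [e1]
    constructor
    · rintro ⟨s, rfl⟩
      exact back ι hι hW a b hd hbb _ s (hg s)
    · rintro ⟨m', hm'⟩
      obtain ⟨s, hs⟩ := forth ι hι hass hW hS a b c ha hb hc hsop hd hba m m' hm'
      exact ⟨s, hι (by rw [hg, hs])⟩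
  have e : (M ⧸ LinearMap.range g) ≃ₗ[R] ((M ⧸ Px a M) ⧸ Ux b (M ⧸ Px a M)) :=
    (Submodule.quotEquivOfEq _ _ hker).trans (φ.quotKerEquivOfSurjective hφ)
  rw [← sl_congr 𝔪 (Hequiv 𝔪 1 e)]
  have hses := ses_inj hginj
  have s2 := H2W (R := R) (S ⧸ LinearMap.range ι) fun p hp => (hW p hp).2
  have hsur := Hmap_surj_of' 𝔪 (ses_inj hι) 2
  have hzero : ∀ z : H 𝔪 2 S, Hmap 𝔪 2 g z = 0 := by
    intro z
    obtain ⟨z, rfl⟩ := hsur z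
    rw [Hmap_comp_apply]
    have hgi : g ∘ₗ ι = a • LinearMap.id := by
      ext m
      apply hι
      change ι (g (ι m)) = ι (a • m)
      rw [hg, map_smul]
    rw [hgi, Hmap_smul_id]
    exact kill2 h0 h1 ha hreg hd a hba z
  refine sl_congr 𝔪 (LinearEquiv.ofBijective (del 𝔪 1 hses) ⟨?_, ?_⟩)
  · rw [injective_iff_map_eq_zero]
    intro z hz
    obtain ⟨w, rfl⟩ := (H_exact₃ 𝔪 1 hses z).1 hz
    rw [Subsingleton.elim w 0, map_zero]
  · intro z
    exact (H_exact₁ 𝔪 1 hses z).1 (hzero z)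

end vpart
end
end LC
end

section
open CategoryTheory Limits Opposite
open IsLocalRing Paper
set_option linter.unusedSectionVars false
namespace LC
noncomputable section
variable {R : Type u} [CommRing R]

section xpart
variable [IsLocalRing R]

local notation "𝔪" => maximalIdeal R

theorem socDim_eq (A : Type u) [AddCommGroup A] [Module R A] : socDim R 𝔪 A = (sl 𝔪 A).toNat := by
  have hF : IsField (R ⧸ 𝔪) := (Ideal.Quotient.maximal_ideal_iff_isField_quotient _).1 inferInstance
  letI : Field (R ⧸ 𝔪) := hF.toField
  unfold socDim sl
  rw [Module.length_eq_of_surjective (R := R ⧸ 𝔪) (S := R) (M := Submodule.torsionBySet R A (𝔪 : Set R))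
    Ideal.Quotient.mk_surjective]
  rw [Module.length_eq_rank]
  rfl

theorem ker_step {M L : Type u} [AddCommGroup M] [Module R M] [AddCommGroup L] [Module R L]
    (f : M →ₗ[R] L) (hf : Function.Surjective f) (I : Ideal R) (h : LinearMap.ker f = I • ⊤) (a : R) :
    LinearMap.ker ((Px a L).mkQ ∘ₗ f) = (I ⊔ Ideal.span {a}) • ⊤ := by
  ext m
  have e1 : m ∈ LinearMap.ker ((Px a L).mkQ ∘ₗ f) ↔ ∃ l, f m = a • l := by
    rw [LinearMap.mem_ker]
    change Submodule.Quotient.mk (f m) = 0 ↔ _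
    rw [Submodule.Quotient.mk_eq_zero]
    exact ⟨fun ⟨v, h⟩ => ⟨v, h.symm⟩, fun ⟨v, h⟩ => ⟨v, h.symm⟩⟩
  rw [e1, Submodule.sup_smul, Submodule.mem_sup]
  constructor
  · rintro ⟨l, hl⟩
    obtain ⟨m', rfl⟩ := hf l
    refine ⟨m - a • m', ?_, a • m', mem_single_smul.2 ⟨m', rfl⟩, by abel⟩
    rw [← h, LinearMap.mem_ker, map_sub, map_smul, hl, sub_self]
  · rintro ⟨y, hy, z, hz, rfl⟩
    obtain ⟨z', rfl⟩ := mem_single_smul.1 hz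
    rw [← h, LinearMap.mem_ker] at hy
    exact ⟨f z', by rw [map_add, hy, zero_add, map_smul]⟩

theorem quot_equiv {M L : Type u} [AddCommGroup M] [Module R M] [AddCommGroup L] [Module R L]
    (f : M →ₗ[R] L) (hf : Function.Surjective f) (I I' : Ideal R) (h : LinearMap.ker f = I • ⊤) (hI : I = I') :
    Nonempty ((M ⧸ (I' • ⊤ : Submodule R M)) ≃ₗ[R] L) := by
  subst hI
  exact ⟨(Submodule.quotEquivOfEq _ _ h.symm).trans (f.quotKerEquivOfSurjective hf)⟩

theorem b_transfer {L L' : Type u} [AddCommGroup L] [Module R L] [AddCommGroup L'] [Module R L']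
    (e : Nonempty (L ≃ₗ[R] L')) {d : ℕ} {c : R} (h : c ∈ bIdeal R L d ^ 3) : c ∈ bIdeal R L' d ^ 3 := by
  obtain ⟨e⟩ := e
  exact Ideal.pow_right_mono (b_congr e d) 3 h

variable [IsNoetherianRing R]
variable {M S : Type u} [AddCommGroup M] [Module R M] [AddCommGroup S] [Module R S]
variable [Module.Finite R M]

theorem main (hum : IsUnmixed R M) (hdim : mdim R M = 3) (hdepth : depth R M = 2)
    (ι : M →ₗ[R] S) (hS : IsS2ification R M S ι)
    (x : Fin 3 → R) (hx : IsCSOP R M 3 x) :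
    ir R M (Ideal.span (Set.range x)) = 2 * socH R M 2 + socH R M 3 + socH R S 2 := by
  obtain ⟨hι, hfin, hS2, hsurj⟩ := hS
  obtain ⟨hxs, hxb⟩ := hx
  obtain ⟨hxm, hxp⟩ := (sop_iff x).1 hxs
  obtain ⟨a, b, c, rfl⟩ : ∃ a b c, x = ![c, b, a] := ⟨x 2, x 1, x 0, by
    ext i; fin_cases i <;> rfl⟩
  have ha : a ∈ 𝔪 := hxm 2
  have hb : b ∈ 𝔪 := hxm 1
  have hc : c ∈ 𝔪 := hxm 0
  have hsop : ∀ p : PrimeSpectrum R, Module.annihilator R M ≤ p.asIdeal → a ∈ p.asIdeal → b ∈ p.asIdeal →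
      c ∈ p.asIdeal → p.asIdeal = 𝔪 := fun p hp h1 h2 h3 => hxp p hp fun i => by
    fin_cases i
    · exact h3
    · exact h2
    · exact h1
  have hM3 : ∀ p : PrimeSpectrum R, Module.annihilator R M ≤ p.asIdeal → cd p ≤ 3 := fun p hp => by
    have := cd_le_dim p hp
    rw [← mdim, hdim] at this
    exact WithBot.coe_le_coe.1 this
  have hass : ∀ p : PrimeSpectrum R, p.asIdeal ∈ associatedPrimes R M → cd p = 3 := fun p hp => by
    have := cd_eq p
    rw [hum _ hp, hdim] at this
    exact WithBot.coe_injective this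
  have hm : Module.annihilator R M ≤ 𝔪 := by
    refine le_maximalIdeal fun h => ?_
    rw [mdim, h] at hdim
    have : ringKrullDim (R ⧸ (⊤ : Ideal R)) = ⊥ := ringKrullDim_eq_bot_of_subsingleton
    rw [this] at hdim
    exact absurd hdim.symm (WithBot.coe_ne_bot (a := (3 : ℕ∞)))
  have hd : ∀ p : PrimeSpectrum R, Module.annihilator R M ≤ p.asIdeal → a ∈ p.asIdeal → cd p ≤ 2 := by
    classical
    intro p hp hap
    refine (cd_le_card p {b, c} ?_ ?_).trans (by exact_mod_cast Finset.card_le_two)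
    · intro q hq hs
      exact hsop q (hp.trans hq) (hq hap) (hs b (by simp)) (hs c (by simp))
    · intro t ht
      rcases Finset.mem_insert.1 ht with rfl | ht
      · exact hb
      · rw [Finset.mem_singleton.1 ht]; exact hc
  have hreg : Function.Injective (a • (LinearMap.id : M →ₗ[R] M)) := by
    refine reg_of fun p hp hap => ?_
    have h1 : Module.annihilator R M ≤ p := by
      have := hp.annihilator_le
      rwa [Submodule.annihilator_top] at this
    have h2 := hd ⟨p, hp.isPrime⟩ h1 hap
    rw [hass ⟨p, hp.isPrime⟩ hp] at h2
    revert h2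
    norm_num
  obtain ⟨h0, h1⟩ := H01_of_depth (R := R) (M := M) hdepth.ge
  have k2 : LinearMap.ker (LinearMap.id : M →ₗ[R] M) = (⊥ : Ideal R) • ⊤ := by
    rw [Submodule.bot_smul, LinearMap.ker_id]
  have s2 : Function.Surjective (LinearMap.id : M →ₗ[R] M) := fun m => ⟨m, rfl⟩
  have k1 := ker_step _ s2 _ k2 a
  have s1 : Function.Surjective ((Px a M).mkQ ∘ₗ (LinearMap.id : M →ₗ[R] M)) := (Submodule.mkQ_surjective _).comp s2
  have k0 := ker_step _ s1 _ k1 b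
  have s0 : Function.Surjective ((Px b (M ⧸ Px a M)).mkQ ∘ₗ (Px a M).mkQ ∘ₗ (LinearMap.id : M →ₗ[R] M)) :=
    (Submodule.mkQ_surjective _).comp s1
  have kk := ker_step _ s0 _ k0 c
  have ss : Function.Surjective ((Px c ((M ⧸ Px a M) ⧸ Px b (M ⧸ Px a M))).mkQ ∘ₗ
      (Px b (M ⧸ Px a M)).mkQ ∘ₗ (Px a M).mkQ ∘ₗ (LinearMap.id : M →ₗ[R] M)) :=
    (Submodule.mkQ_surjective _).comp s0
  have i2 : (![c, b, a] '' {j | (2 : Fin 3) < j}) = ∅ := by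
    rw [Set.image_eq_empty]
    ext j
    fin_cases j <;> simp
  have i1 : (![c, b, a] '' {j | (1 : Fin 3) < j}) = {a} := by
    have : {j | (1 : Fin 3) < j} = {2} := by
      ext j
      fin_cases j <;> simp
    rw [this]
    simp
  have i0 : (![c, b, a] '' {j | (0 : Fin 3) < j}) = {a, b} := by
    have : {j | (0 : Fin 3) < j} = {2, 1} := by
      ext j
      fin_cases j <;> simp
    rw [this, Set.image_pair]
    simp
  have ii : Set.range ![c, b, a] = {a, b, c} := by
    ext z
    simp only [Set.mem_range, Set.mem_insert_iff, Set.mem_singleton_iff]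
    constructor
    · rintro ⟨i, rfl⟩
      fin_cases i <;> simp
    · rintro (rfl | rfl | rfl)
      · exact ⟨2, rfl⟩
      · exact ⟨1, rfl⟩
      · exact ⟨0, rfl⟩
  have hba : a ∈ bIdeal R M 3 ^ 3 := b_transfer
    (quot_equiv _ s2 _ (Ideal.span (![c, b, a] '' {j | (2 : Fin 3) < j})) k2 (by rw [i2, Ideal.span_empty])) (hxb 2)
  have hbb : b ∈ bIdeal R (M ⧸ Px a M) 2 ^ 3 := b_transfer
    (quot_equiv _ s1 _ (Ideal.span (![c, b, a] '' {j | (1 : Fin 3) < j})) k1 (by rw [i1, bot_sup_eq])) (hxb 1)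
  have hbc : c ∈ bIdeal R ((M ⧸ Px a M) ⧸ Px b (M ⧸ Px a M)) 1 ^ 3 := b_transfer
    (quot_equiv _ s0 _ (Ideal.span (![c, b, a] '' {j | (0 : Fin 3) < j})) k0
      (by rw [i0, bot_sup_eq, Ideal.span_insert])) (hxb 0)
  obtain ⟨eq⟩ := quot_equiv _ ss _ (Ideal.span (Set.range ![c, b, a])) kk
    (by rw [ii, bot_sup_eq, Ideal.span_insert, Ideal.span_insert, sup_assoc])
  have hsum := main_sum a b c ha hb hc hsop h0 h1 hreg hba hbb hbc
  have hW := supp_W ι hM3 hass hm hsurj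
  rw [final_S ι hι hM3 hass hW hS2 a b c ha hb hc hsop hd h0 h1 hreg (cube_mem' hba) (cube_mem' hbb)] at hsum
  have htor : Tors (((M ⧸ Px a M) ⧸ Px b (M ⧸ Px a M)) ⧸ Px c ((M ⧸ Px a M) ⧸ Px b (M ⧸ Px a M))) 𝔪 := by
    refine tors_of fun p hp => ?_
    have t0 := ann_Px hp
    have t1 := ann_Px t0.1
    have t2 := ann_Px t1.1
    exact hsop p t2.1 t2.2 t1.2 t0.2
  have eth : H 𝔪 0 (((M ⧸ Px a M) ⧸ Px b (M ⧸ Px a M)) ⧸ Px c ((M ⧸ Px a M) ⧸ Px b (M ⧸ Px a M))) ≃ₗ[R]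
      (((M ⧸ Px a M) ⧸ Px b (M ⧸ Px a M)) ⧸ Px c ((M ⧸ Px a M) ⧸ Px b (M ⧸ Px a M))) :=
    LinearEquiv.ofBijective (theta 𝔪 _) ⟨theta_inj 𝔪, fun y => (theta_range 𝔪 y).2 (htor y)⟩
  rw [sl_congr 𝔪 (eth.trans eq.symm)] at hsum
  have hne : sl 𝔪 (M ⧸ (Ideal.span (Set.range ![c, b, a]) • ⊤ : Submodule R M)) ≠ ⊤ := by
    obtain ⟨f1, f2⟩ := isFiniteLength_iff_isNoetherian_isArtinian.1 hxs.2
    exact Module.length_ne_top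
  rw [hsum] at hne
  unfold ir socH
  rw [socDim_eq, socDim_eq, socDim_eq, socDim_eq, hsum, ← sl_congr 𝔪 (lcEquiv 𝔪 2 M), ← sl_congr 𝔪 (lcEquiv 𝔪 3 M),
    ← sl_congr 𝔪 (lcEquiv 𝔪 2 S)]
  generalize sl 𝔪 (H 𝔪 2 M) = n1 at *
  generalize sl 𝔪 (H 𝔪 3 M) = n2 at *
  generalize sl 𝔪 (H 𝔪 2 S) = n3 at *
  have u3 : n3 ≠ ⊤ := fun h => hne (by rw [h, add_top])
  have u2 : n2 ≠ ⊤ := fun h => hne (by rw [h, add_top, top_add])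
  have u1 : n1 ≠ ⊤ := fun h => hne (by rw [h, ENat.mul_top (by norm_num), top_add, top_add])
  obtain ⟨n1, rfl⟩ := ENat.ne_top_iff_exists.1 u1
  obtain ⟨n2, rfl⟩ := ENat.ne_top_iff_exists.1 u2
  obtain ⟨n3, rfl⟩ := ENat.ne_top_iff_exists.1 u3
  have : (2 * (n1 : ℕ∞) + n2 + n3) = ((2 * n1 + n2 + n3 : ℕ) : ℕ∞) := by push_cast; rfl
  rw [this]
  simp only [ENat.toNat_natCast]

end xpart
end
end LC
end

open Paper IsLocalRing

/-- If `M` is unmixed of dimension 3 and depth 2 and `S` is an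
`S_2`-ification of `M`, then
`N_R(M) = 2·dim_k Soc(H^2_m(M)) + dim_k Soc(H^3_m(M)) + dim_k Soc(H^2_m(S))`,
where `N_R(M)` is realized as the index of reducibility of any C-system of parameters. -/
theorem stmt14 (R : Type u) [CommRing R] [IsLocalRing R] [IsNoetherianRing R]
    (hCM : IsQuotientOfCMLocalRing R)
    (M : Type u) [AddCommGroup M] [Module R M] [Module.Finite R M]
    (hum : IsUnmixed R M) (hdim : mdim R M = 3) (hdepth : depth R M = 2)
    (S : Type u) [AddCommGroup S] [Module R S]
    (ι : M →ₗ[R] S) (hS : IsS2ification R M S ι)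
    (x : Fin 3 → R) (hx : IsCSOP R M 3 x) :
    ir R M (Ideal.span (Set.range x)) = 2 * socH R M 2 + socH R M 3 + socH R S 2 := by
  exact LC.main hum hdim hdepth ι hS x hx
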